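/- arXiv:1910.10876 — 7 statements merged into one kernel-verified Lean document; each statement's English description precedes it below -/
import Mathlib

section
/- For every integer k ≥ 2 and every integer n > k, the domination number of the bipartite graph G_{k,1} equals n − k + 1. -/
/-- `(E, K)` is a dominating set of the bipartite graph `G_{k,l}` whose vertex
classes are the `k`-element and `l`-element subsets of `[n] = {1, …, n}`
(modelled as `Finset.range n`), a `k`-set `A` being adjacent to an `l`-set `B`
iff `B ⊆ A`. -/
def IsDomSet (n k l : ℕ) (E K : Finset (Finset ℕ)) : Prop :=
  (∀ e ∈ E, e ⊆ Finset.range n ∧ e.card = l) ∧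
  (∀ A ∈ K, A ⊆ Finset.range n ∧ A.card = k) ∧
  (∀ A, A ⊆ Finset.range n → A.card = k → A ∉ K → ∃ e ∈ E, e ⊆ A) ∧
  (∀ e, e ⊆ Finset.range n → e.card = l → e ∉ E → ∃ A ∈ K, e ⊆ A)

/-- The domination number `γ(G_{k,l})`: the minimum of `|E| + |K|` over all
dominating sets `(E, K)` of `G_{k,l}`. -/
noncomputable def gamma (n k l : ℕ) : ℕ :=
  sInf {m | ∃ E K : Finset (Finset ℕ), IsDomSet n k l E K ∧ m = E.card + K.card}

theorem succ_le_choose_add {k : ℕ} (hk : 1 ≤ k) (u : ℕ) : u + 1 ≤ u.choose k + k := by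
  obtain ⟨k, rfl⟩ := Nat.exists_eq_add_of_le' hk
  induction u with
  | zero => omega
  | succ u ih =>
    rw [Nat.choose_succ_succ']
    rcases Nat.lt_or_ge u k with h | h
    · omega
    · have := Nat.choose_pos h
      omega

/-- A set of singletons together with a single `k`-set gives a small dominating set. -/
theorem isDomSet_singletons {k n : ℕ} (hn : k ≤ n) :
    IsDomSet n k 1 ((Finset.Ico k n).image fun x => {x}) {Finset.range k} := by
  refine ⟨?_, ?_, ?_, ?_⟩
  · intro e he
    obtain ⟨x, hx, rfl⟩ := Finset.mem_image.1 he
    simpa using (Finset.mem_Ico.1 hx).2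
  · intro A hA
    rw [Finset.mem_singleton.1 hA]
    exact ⟨Finset.range_subset_range.2 hn, Finset.card_range k⟩
  · intro A hA hc hAK
    by_contra! h
    refine hAK (Finset.mem_singleton.2 (Finset.eq_of_subset_of_card_le ?_ (by simp [hc])))
    intro x hx
    by_contra hxk
    refine h {x} (Finset.mem_image.2 ⟨x, ?_, rfl⟩) (Finset.singleton_subset_iff.2 hx)
    exact Finset.mem_Ico.2 ⟨by simpa using hxk, Finset.mem_range.1 (hA hx)⟩
  · intro e he hc heE
    obtain ⟨x, rfl⟩ := Finset.card_eq_one.1 hc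
    refine ⟨_, Finset.mem_singleton_self _, Finset.singleton_subset_iff.2 ?_⟩
    by_contra hxk
    refine heE (Finset.mem_image.2 ⟨x, ?_, rfl⟩)
    exact Finset.mem_Ico.2 ⟨by simpa using hxk, by simpa using he⟩

theorem IsDomSet.le_card_add_card {k n : ℕ} {E K : Finset (Finset ℕ)} (hk : 1 ≤ k)
    (h : IsDomSet n k 1 E K) : n + 1 ≤ E.card + K.card + k := by
  obtain ⟨hE, -, hK, -⟩ := h
  set U := Finset.range n \ E.biUnion id with hU
  have hcover : (E.biUnion id).card ≤ E.card := by
    simpa using Finset.card_biUnion_le_card_mul E id 1 fun e he => (hE e he).2.le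
  have hUcard : n ≤ U.card + E.card := by
    have := Finset.le_card_sdiff (E.biUnion id) (Finset.range n)
    rw [← hU, Finset.card_range] at this
    omega
  have hsub : U.powersetCard k ⊆ K := by
    intro A hA
    obtain ⟨hAU, hc⟩ := Finset.mem_powersetCard.1 hA
    by_contra hAK
    obtain ⟨e, he, heA⟩ := hK A (hAU.trans Finset.sdiff_subset) hc hAK
    obtain ⟨x, rfl⟩ := Finset.card_eq_one.1 (hE e he).2
    have hx := hAU (heA (Finset.mem_singleton_self x))
    exact (Finset.mem_sdiff.1 hx).2
      (Finset.mem_biUnion.2 ⟨_, he, Finset.mem_singleton_self x⟩)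
  have hchoose := Finset.card_le_card hsub
  rw [Finset.card_powersetCard] at hchoose
  have := succ_le_choose_add hk U.card
  omega

/-- For every integer `k ≥ 2` and every integer `n > k`, the domination number
of `G_{k,1}` equals `n - k + 1`. -/
theorem domination_number_Gk1 (k n : ℕ) (hk : 2 ≤ k) (hn : k < n) :
    gamma n k 1 = n - k + 1 := by
  have hmem : n - k + 1 ∈ {m | ∃ E K : Finset (Finset ℕ),
      IsDomSet n k 1 E K ∧ m = E.card + K.card} := by
    refine ⟨_, _, isDomSet_singletons hn.le, ?_⟩
    rw [Finset.card_image_of_injective _ Finset.singleton_injective, Nat.card_Ico,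
      Finset.card_singleton]
  refine le_antisymm (Nat.sInf_le hmem) (le_csInf ⟨_, hmem⟩ ?_)
  rintro m ⟨E, K, h, rfl⟩
  have := h.le_card_add_card (by omega)
  omega
end

section
/- For every fixed integer k ≥ 3, the domination number of G_{k,2} satisfies γ(G_{k,2}) = (k+3)/(2(k−1)(k+1)) · n² + o(n²) as n → ∞; that is, the function n ↦ γ(G_{k,2}) − (k+3)/(2(k−1)(k+1)) · n² is o(n²). -/
open Finset

/-- A graph `H` on `V` whose complement has no `k`-clique, together with a family `K` of sets of at
most `k` vertices covering all pairs not joined in `H`; the real number `c` bounds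
`2 (|E(H)| + |K|)`. -/
def HasCover (V : Type) [Fintype V] (k : ℕ) (c : ℝ) : Prop :=
  ∃ (H : SimpleGraph V) (K : Finset (Finset V)), Hᶜ.CliqueFree k ∧ (∀ A ∈ K, #A ≤ k) ∧
    (∀ u v, u ≠ v → ¬ H.Adj u v → ∃ A ∈ K, u ∈ A ∧ v ∈ A) ∧
    (Nat.card {p : V × V // H.Adj p.1 p.2} : ℝ) + 2 * #K ≤ c

lemma card_filter_val_lt_of_surjective {G : Type} [Group G] [Fintype G] {r : ℕ}
    (χ : G →* Multiplicative (ZMod (r + 2))) (hχ : Function.Surjective χ) :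
    (r + 2) * #{b : G | (χ b).toAdd.val < r} = r * Fintype.card G := by
  classical
  have fib (c) : #{b : G | χ b = c} = #{b : G | χ b = 1} :=
    MonoidHom.card_fiber_eq_of_mem_range χ (hχ c) (hχ 1)
  have count (S : Finset (Multiplicative (ZMod (r + 2)))) :
      #{b : G | χ b ∈ S} = #S * #{b : G | χ b = 1} := by
    rw [card_eq_sum_card_fiberwise (f := χ) (t := S) (fun b hb => by simpa using hb)]
    rw [sum_congr rfl (g := fun _ => #{b : G | χ b = 1})]
    · simp
    · intro c hc
      rw [← fib c, filter_filter]
      congr 1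
      ext b
      simp only [mem_filter, mem_univ, true_and]
      exact ⟨fun h => h.2, fun h => ⟨h ▸ hc, h⟩⟩
  have h1 := count (univ.filter fun c => c.toAdd.val < r)
  have h2 := count univ
  have h3 : #(univ.filter fun c : Multiplicative (ZMod (r + 2)) => c.toAdd.val < r) = r := by
    have : #(univ.filter fun c : Fin (r + 2) => c.val < r) = r := by
      rw [Fin.card_filter_val_lt]; simp
    refine Eq.trans (card_equiv (Multiplicative.toAdd : _ ≃ Fin (r + 2)) fun c => ?_) this
    simp only [mem_filter, mem_univ]
    rfl
  simp only [mem_filter, mem_univ, true_and, h3] at h1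
  simp only [mem_univ, filter_true, card_univ, Fintype.card_multiplicative, ZMod.card] at h2
  rw [h1, h2]
  ring

/-- A near-decomposition of the complete `r`-partite graph with classes `{i} × M` into copies of
`K_{2,1,…,1}` obtained by translating base blocks indexed by the units of `M`. -/
lemma hasCover_of_character {M : Type} [Ring M] [Fintype M] [Fintype Mˣ] {r : ℕ}
    (χ : Mˣ →* Multiplicative (ZMod (r + 2))) (hχ : Function.Surjective χ) (hneg : χ (-1) = 1)
    (X Y : Fin r → M) (C D : Fin r → Fin r → Mˣ)
    (hC : ∀ i j, i ≠ j → (C i j : M) = X i - X j) (hC' : ∀ i j, i ≠ j → χ (C i j) = 1)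
    (hD : ∀ i j, i ≠ j → (D i j : M) = Y i - X j)
    (hD₁ : ∀ i j, i < j → χ (D i j) = Multiplicative.ofAdd ((r : ZMod (r + 2)) - (i : ℕ)))
    (hD₂ : ∀ i j, j < i → χ (D i j) = Multiplicative.ofAdd ((r + 1 : ZMod (r + 2)) - (i : ℕ))) :
    HasCover (Fin r × M) (r + 1) (r * (Fintype.card M : ℝ) ^ 2
      + r ^ 2 * Fintype.card M * (Fintype.card M - Fintype.card Mˣ)
      + 2 * (r / (r + 2) * (Fintype.card M : ℝ) ^ 2)) := by
  classical
  let H : SimpleGraph (Fin r × M) :=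
    { Adj := fun p q => (p.1 = q.1 ∧ p.2 ≠ q.2) ∨ (p.1 ≠ q.1 ∧ ¬ IsUnit (p.2 - q.2))
      symm := ⟨by
        rintro ⟨i, a⟩ ⟨j, b⟩ (h | h)
        · exact Or.inl ⟨h.1.symm, h.2.symm⟩
        · refine Or.inr ⟨h.1.symm, ?_⟩
          rw [← neg_sub, IsUnit.neg_iff]
          exact h.2⟩
      loopless := ⟨by rintro ⟨i, a⟩ (h | h) <;> simp at h⟩ }
  let T := {b : Mˣ // (χ b).toAdd.val < r}
  let blk : M × T → Finset (Fin r × M) := fun p =>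
    insert (⟨_, p.2.2⟩, p.1 + Y ⟨_, p.2.2⟩ * p.2.1) (univ.image fun j => (j, p.1 + X j * p.2.1))
  have vert (a : M) (b : T) (j : Fin r) : (j, a + X j * b.1) ∈ blk (a, b) :=
    mem_insert_of_mem (mem_image_of_mem _ (mem_univ j))
  have key : ∀ i j : Fin r, i < j → ∀ u v : M, IsUnit (u - v) →
      ∃ p : M × T, (i, u) ∈ blk p ∧ (j, v) ∈ blk p := by
    rintro i j hij u v ⟨δ, hδ⟩
    have hv : (χ δ).toAdd.val < r + 2 := ZMod.val_lt _
    have cast : (χ δ).toAdd = (((χ δ).toAdd.val : ℕ) : ZMod (r + 2)) := by simp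
    rcases lt_trichotomy (χ δ).toAdd.val r with h | h | h
    · have e : X i * ((C i j)⁻¹ * δ : Mˣ) = X j * ((C i j)⁻¹ * δ : Mˣ) + (u - v) := by
        rw [← sub_eq_iff_eq_add', ← sub_mul, ← hC i j hij.ne, ← hδ]
        norm_cast; simp
      refine ⟨(u - X i * ((C i j)⁻¹ * δ : Mˣ), ⟨(C i j)⁻¹ * δ, ?_⟩), ?_, ?_⟩
      · simpa [hC' i j hij.ne] using h
      · convert vert _ _ i using 2; simp
      · convert vert _ _ j using 2; simp only [e]; abel
    · set b := (D i j)⁻¹ * δ with hb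
      have hχb : (χ b).toAdd = ((i : ℕ) : ZMod (r + 2)) := by
        rw [hb, map_mul, map_inv, hD₁ i j hij, toAdd_mul, toAdd_inv, toAdd_ofAdd, cast, h]; ring
      have hval : (χ b).toAdd.val = i := by
        rw [hχb, ZMod.val_natCast_of_lt (by omega)]
      have e : Y i * (b : M) = X j * (b : M) + (u - v) := by
        rw [← sub_eq_iff_eq_add', ← sub_mul, ← hD i j hij.ne, ← hδ]
        norm_cast; simp [hb]
      refine ⟨(v - X j * b, ⟨b, by omega⟩), ?_, ?_⟩
      · have : (⟨(χ b).toAdd.val, by omega⟩ : Fin r) = i := Fin.ext hval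
        refine mem_insert.2 (Or.inl ?_)
        dsimp only
        rw [this, e]
        congr 1; abel
      · convert vert _ _ j using 2; simp
    · have h : (χ δ).toAdd.val = r + 1 := by omega
      set b := -(D j i)⁻¹ * δ with hb
      have hχb : (χ b).toAdd = ((j : ℕ) : ZMod (r + 2)) := by
        rw [hb, neg_mul, ← neg_one_mul, map_mul, hneg, one_mul, map_mul, map_inv, hD₂ j i hij,
          toAdd_mul, toAdd_inv, toAdd_ofAdd, cast, h]
        push_cast; ring
      have hval : (χ b).toAdd.val = j := by
        rw [hχb, ZMod.val_natCast_of_lt (by omega)]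
      have e : X i * (b : M) = Y j * (b : M) + (u - v) := by
        rw [← sub_eq_iff_eq_add', ← sub_mul, ← neg_sub, ← hD j i hij.ne', ← hδ]
        simp [hb]
      refine ⟨(u - X i * b, ⟨b, by omega⟩), ?_, ?_⟩
      · convert vert _ _ i using 2; simp
      · have : (⟨(χ b).toAdd.val, by omega⟩ : Fin r) = j := Fin.ext hval
        refine mem_insert.2 (Or.inl ?_)
        dsimp only
        rw [this, e]
        congr 1; abel
  refine ⟨H, univ.image blk, ?_, ?_, ?_, ?_⟩
  · intro s hs
    obtain ⟨p, hp, q, hq, hpq, h⟩ := exists_ne_map_eq_of_card_lt_of_maps_to (s := s)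
      (t := (univ : Finset (Fin r))) (by simp [hs.2]) (f := Prod.fst) (fun _ _ => by simp)
    have := hs.1 hp hq hpq
    rw [SimpleGraph.compl_adj] at this
    exact this.2 (Or.inl ⟨h, fun h' => hpq (Prod.ext h h')⟩)
  · intro A hA
    obtain ⟨p, -, rfl⟩ := mem_image.1 hA
    refine (card_insert_le _ _).trans (Nat.succ_le_succ ?_)
    exact card_image_le.trans (by simp)
  · rintro ⟨i, u⟩ ⟨j, v⟩ huv hH
    have hij : i ≠ j := by
      rintro rfl
      exact hH (Or.inl ⟨rfl, fun h => huv (by simpa using h)⟩)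
    have hu : IsUnit (u - v) := by
      by_contra h
      exact hH (Or.inr ⟨hij, h⟩)
    rcases hij.lt_or_gt with h | h
    · obtain ⟨p, h1, h2⟩ := key i j h u v hu
      exact ⟨_, mem_image_of_mem _ (mem_univ p), h1, h2⟩
    · obtain ⟨p, h1, h2⟩ := key j i h v u (by rwa [← neg_sub, IsUnit.neg_iff])
      exact ⟨_, mem_image_of_mem _ (mem_univ p), h2, h1⟩
  · have hunits : Fintype.card {x : M // ¬ IsUnit x} = Fintype.card M - Fintype.card Mˣ := by
      rw [Fintype.card_subtype_compl,
        Fintype.card_congr (Equiv.ofInjective _ (Units.val_injective (α := M)))]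
      exact congrArg _ (Fintype.card_congr (Equiv.refl _))
    have hle : Fintype.card Mˣ ≤ Fintype.card M := Fintype.card_le_of_injective _ Units.val_injective
    have hH : Nat.card {p : (Fin r × M) × (Fin r × M) // H.Adj p.1 p.2} ≤
        r * Fintype.card M ^ 2 + r ^ 2 * Fintype.card M * (Fintype.card M - Fintype.card Mˣ) := by
      let f : {p : (Fin r × M) × (Fin r × M) // H.Adj p.1 p.2} →
          (Fin r × M × M) ⊕ ((Fin r × Fin r) × M × {x : M // ¬ IsUnit x}) := fun p =>
        if h : p.1.1.1 = p.1.2.1 then Sum.inl (p.1.1.1, p.1.1.2, p.1.2.2)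
        else Sum.inr ((p.1.1.1, p.1.2.1), p.1.1.2, ⟨p.1.1.2 - p.1.2.2, by
          rcases p.2 with h' | h'
          exacts [absurd h'.1 h, h'.2]⟩)
      have hf : Function.Injective f := by
        rintro ⟨⟨⟨i, a⟩, ⟨j, b⟩⟩, h⟩ ⟨⟨⟨i', a'⟩, ⟨j', b'⟩⟩, h'⟩ hff
        simp only [f] at hff
        split_ifs at hff with h1 h2 h2
        · simp_all
        · simp only [Sum.inr.injEq, Prod.mk.injEq, Subtype.mk.injEq] at hff
          obtain ⟨⟨rfl, rfl⟩, rfl, h3⟩ := hff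
          simpa using h3
      rw [Nat.card_eq_fintype_card]
      refine (Fintype.card_le_of_injective f hf).trans (le_of_eq ?_)
      simp only [Fintype.card_sum, Fintype.card_prod, Fintype.card_fin, hunits]
      ring
    have hK : #(univ.image blk) ≤ Fintype.card M * #{b : Mˣ | (χ b).toAdd.val < r} := by
      refine card_image_le.trans (le_of_eq ?_)
      rw [card_univ, Fintype.card_prod, Fintype.card_subtype]
    have hcount := card_filter_val_lt_of_surjective χ hχ
    have hK' : (#(univ.image blk) : ℝ) ≤ r / (r + 2) * (Fintype.card M : ℝ) ^ 2 := by
      have h1 : (#(univ.image blk) : ℝ) ≤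
        Fintype.card M * #{b : Mˣ | (χ b).toAdd.val < r} := mod_cast hK
      have h2 : ((r : ℝ) + 2) * #{b : Mˣ | (χ b).toAdd.val < r} = r * Fintype.card Mˣ :=
        mod_cast hcount
      have h3 : (#{b : Mˣ | (χ b).toAdd.val < r} : ℝ) ≤ r / (r + 2) * Fintype.card M := by
        rw [div_mul_eq_mul_div, le_div_iff₀ (by positivity), mul_comm, h2]
        gcongr
      refine h1.trans ((mul_le_mul_of_nonneg_left h3 (by positivity)).trans (le_of_eq (by ring)))
    have hH' : (Nat.card {p : (Fin r × M) × (Fin r × M) // H.Adj p.1 p.2} : ℝ) ≤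
        r * (Fintype.card M : ℝ) ^ 2
          + r ^ 2 * Fintype.card M * (Fintype.card M - Fintype.card Mˣ) := by
      have := Nat.cast_le (α := ℝ).2 hH
      push_cast [Nat.cast_sub hle] at this
      exact this
    linarith

lemma HasCover.mono {V : Type} [Fintype V] {k : ℕ} {c c' : ℝ} (h : HasCover V k c) (hc : c ≤ c') :
    HasCover V k c' := by
  obtain ⟨H, K, h1, h2, h3, h4⟩ := h
  exact ⟨H, K, h1, h2, h3, h4.trans hc⟩

lemma exists_matrix_charpoly_eq {F : Type} [Field F] {n : ℕ} (f : Polynomial F) (hf : f.Monic)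
    (hn : f.natDegree = n) : ∃ Y : Matrix (Fin n) (Fin n) F, Y.charpoly = f := by
  subst hn
  refine ⟨Algebra.leftMulMatrix (AdjoinRoot.powerBasis' hf).basis
    (AdjoinRoot.powerBasis' hf).gen, ?_⟩
  have h := charpoly_leftMulMatrix (AdjoinRoot.powerBasis' hf)
  refine h.trans ?_
  rw [AdjoinRoot.powerBasis'_gen, AdjoinRoot.minpoly_root hf.ne_zero, hf.leadingCoeff]
  simp

lemma exists_matrix_det_scalar_sub_eq {F : Type} [Field F] {r : ℕ} (x v : Fin r → F)
    (hx : Function.Injective x) :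
    ∃ Y : Matrix (Fin (r + 2)) (Fin (r + 2)) F,
      ∀ j, (Matrix.scalar (Fin (r + 2)) (x j) - Y).det = v j := by
  classical
  let P : Polynomial F := Polynomial.X ^ 2 * ∏ j, (Polynomial.X - Polynomial.C (x j))
  have hmon : (∏ j, (Polynomial.X - Polynomial.C (x j))).Monic :=
    Polynomial.monic_prod_of_monic _ _ fun j _ => Polynomial.monic_X_sub_C _
  have hP : P.Monic := (Polynomial.monic_X_pow 2).mul hmon
  have hPd : P.natDegree = r + 2 := by
    rw [(Polynomial.monic_X_pow 2).natDegree_mul hmon, Polynomial.natDegree_prod_of_monic _ _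
      fun j _ => Polynomial.monic_X_sub_C _]
    simp [add_comm]
  let g := Lagrange.interpolate univ x v
  have hg : g.degree < P.degree := by
    refine (Lagrange.degree_interpolate_lt v hx.injOn).trans_le ?_
    rw [Polynomial.degree_eq_natDegree hP.ne_zero, hPd]
    simp only [card_univ, Fintype.card_fin]
    exact_mod_cast Nat.le_add_right r 2
  obtain ⟨Y, hY⟩ := exists_matrix_charpoly_eq (n := r + 2) (P + g) (hP.add_of_left hg) (by
    rw [Polynomial.natDegree_add_eq_left_of_degree_lt hg, hPd])
  refine ⟨Y, fun j => ?_⟩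
  rw [← Matrix.eval_charpoly, hY, Polynomial.eval_add,
    Lagrange.eval_interpolate_at_node v hx.injOn (mem_univ j)]
  simp [P, Polynomial.eval_prod, prod_eq_zero (mem_univ j)]

lemma exists_surjective_character {G : Type} [Group G] [IsCyclic G] {m : ℕ} (h : m ∣ Nat.card G) :
    ∃ η : G →* Multiplicative (ZMod m), Function.Surjective η := by
  let e := zmodCyclicMulEquiv (G := G) inferInstance
  refine ⟨(AddMonoidHom.toMultiplicative (ZMod.castHom h (ZMod m)).toAddMonoidHom).comp
    e.symm.toMonoidHom, ?_⟩
  refine Function.Surjective.comp (g := AddMonoidHom.toMultiplicative _) ?_ e.symm.surjective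
  exact ZMod.castHom_surjective h

lemma card_square_matrix_zmod {q m : ℕ} [NeZero q] :
    Fintype.card (Matrix (Fin m) (Fin m) (ZMod q)) = q ^ (m * m) := by
  rw [Fintype.card_congr Matrix.of.symm]
  simp [pow_mul]

lemma one_sub_div_mul_le_card_GL {q m : ℕ} [Fact q.Prime] :
    (1 - (m : ℝ) / q) * Nat.card (Matrix (Fin m) (Fin m) (ZMod q))
      ≤ Nat.card (GL (Fin m) (ZMod q)) := by
  have hq : (1 : ℝ) ≤ q := mod_cast (Fact.out : q.Prime).one_lt.le
  have hq0 : (0 : ℝ) < q := by linarith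
  rw [Matrix.card_GL_field, Nat.card_eq_fintype_card, card_square_matrix_zmod, ZMod.card]
  push_cast
  have h1 : 1 - (m : ℝ) / q ≤ (1 - 1 / (q : ℝ)) ^ m := by
    have := one_add_mul_le_pow (a := -(1 / (q : ℝ))) (by
      have : 1 / (q : ℝ) ≤ 1 := by rw [div_le_one hq0]; exact hq
      linarith) m
    calc _ = 1 + (m : ℝ) * -(1 / (q : ℝ)) := by ring
      _ ≤ _ := this
      _ = _ := by ring
  calc (1 - (m : ℝ) / q) * (q : ℝ) ^ (m * m)
      ≤ (1 - 1 / (q : ℝ)) ^ m * (q : ℝ) ^ (m * m) := by gcongr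
    _ = ∏ _i : Fin m, ((1 - 1 / (q : ℝ)) * (q : ℝ) ^ m) := by
      simp [mul_pow, pow_mul]
    _ ≤ _ := by
      refine prod_le_prod (fun i _ => ?_) fun i _ => ?_
      · have : 1 / (q : ℝ) ≤ 1 := by rw [div_le_one hq0]; exact hq
        have : 0 ≤ 1 - 1 / (q : ℝ) := by linarith
        positivity
      · have hi : q ^ (i : ℕ) ≤ q ^ m :=
          Nat.pow_le_pow_right (Fact.out : q.Prime).pos i.2.le
        have h2 : (q : ℝ) ^ (i : ℕ) * q ≤ (q : ℝ) ^ m := by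
          rw [← pow_succ]
          exact pow_le_pow_right₀ hq i.2
        have h3 : (q : ℝ) ^ (i : ℕ) ≤ 1 / (q : ℝ) * (q : ℝ) ^ m := by
          rw [div_mul_eq_mul_div, one_mul, le_div_iff₀ hq0]
          exact h2
        push_cast [Nat.cast_sub hi]
        linarith

lemma exists_hasCover_large {r : ℕ} (hr : 1 ≤ r) {ε : ℝ} (hε : 0 < ε) (N : ℕ) :
    ∃ (V : Type) (_ : Fintype V), N ≤ Fintype.card V ∧
      HasCover V (r + 1) ((1 / r + 2 / (r * (r + 2)) + ε) * (Fintype.card V : ℝ) ^ 2) := by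
  classical
  obtain ⟨q, hq, hqN, hqm⟩ :=
    Nat.exists_prime_gt_modEq_one (k := r + 2) (N + r + ⌈(r + 2) / ε⌉₊) (by omega)
  have : Fact q.Prime := ⟨hq⟩
  have hdvd : r + 2 ∣ Nat.card (ZMod q)ˣ := by
    rw [Nat.card_eq_fintype_card, ZMod.card_units]
    exact (Nat.modEq_iff_dvd' hq.one_lt.le).1 hqm.symm
  obtain ⟨η, hη⟩ := exists_surjective_character hdvd
  have hηpow (u : (ZMod q)ˣ) : η (u ^ (r + 2)) = 1 := by
    rw [map_pow]
    have := pow_card_eq_one' (x := η u)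
    simpa using this
  let M := Matrix (Fin (r + 2)) (Fin (r + 2)) (ZMod q)
  let χ : Mˣ →* Multiplicative (ZMod (r + 2)) := η.comp Matrix.GeneralLinearGroup.det
  have hdet : Function.Surjective
      (Matrix.GeneralLinearGroup.det : GL (Fin (r + 2)) (ZMod q) →* (ZMod q)ˣ) := by
    intro u
    refine ⟨Matrix.GeneralLinearGroup.mkOfDetNeZero
      (Matrix.diagonal (Function.update 1 0 (u : ZMod q))) ?_, ?_⟩
    · simp [Matrix.det_diagonal, prod_update_of_mem]
    · ext
      simp [Matrix.GeneralLinearGroup.mkOfDetNeZero, Matrix.det_diagonal, prod_update_of_mem]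
  have mk (A : M) (u : (ZMod q)ˣ) (h : A.det = u) : ∃ B : Mˣ, (B : M) = A ∧ χ B = η u := by
    refine ⟨Matrix.GeneralLinearGroup.mkOfDetNeZero A (by rw [h]; exact u.ne_zero), rfl, ?_⟩
    refine congrArg η (Units.ext ?_)
    exact h
  let x : Fin r → ZMod q := fun i => ((i : ℕ) : ZMod q)
  have hx : Function.Injective x := by
    intro i j h
    have := congrArg ZMod.val h
    simp only [x] at this
    rw [ZMod.val_natCast_of_lt (by omega), ZMod.val_natCast_of_lt (by omega)] at this
    exact Fin.ext this
  choose w hw using hη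
  let tgt : Fin r → Fin r → Multiplicative (ZMod (r + 2)) := fun i j =>
    if i < j then Multiplicative.ofAdd ((r : ZMod (r + 2)) - (i : ℕ))
    else Multiplicative.ofAdd ((r + 1 : ZMod (r + 2)) - (i : ℕ))
  have hY (i : Fin r) := exists_matrix_det_scalar_sub_eq x
    (fun j => (-1) ^ (r + 2) * (w (tgt i j) : ZMod q)) hx
  choose Y hY using hY
  let X : Fin r → M := fun i => Matrix.scalar _ (x i)
  have hCex (i j : Fin r) : ∃ B : Mˣ, i ≠ j → (B : M) = X i - X j ∧ χ B = 1 := by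
    by_cases hij : i = j
    · exact ⟨1, fun h => absurd hij h⟩
    have hne : x i - x j ≠ 0 := sub_ne_zero.2 fun h => hij (hx h)
    obtain ⟨B, h1, h2⟩ := mk (X i - X j) (Units.mk0 _ hne ^ (r + 2)) (by
      simp only [X, ← map_sub]
      exact (Matrix.det_diagonal).trans (by simp))
    exact ⟨B, fun _ => ⟨h1, h2.trans (hηpow _)⟩⟩
  have hDex (i j : Fin r) : ∃ B : Mˣ, (B : M) = Y i - X j ∧ χ B = tgt i j := by
    obtain ⟨B, h1, h2⟩ := mk (Y i - X j) (w (tgt i j)) (by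
      rw [← neg_sub, Matrix.det_neg, hY, ← mul_assoc, Fintype.card_fin, ← mul_pow]
      simp)
    exact ⟨B, h1, h2.trans (hw _)⟩
  choose C hC using hCex
  choose D hD using hDex
  have hneg : χ (-1) = 1 := by
    obtain ⟨B, h1, h2⟩ := mk (-1) ((-1) ^ (r + 2)) ((Matrix.det_neg _).trans (by simp))
    rw [show (-1 : Mˣ) = B from Units.ext (by simp [h1]), h2, hηpow]
  have hcov := hasCover_of_character χ (fun c => by
      obtain ⟨B, hB⟩ := hdet (w c)
      exact ⟨B, (congrArg η hB).trans (hw c)⟩) hneg X Y C D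
    (fun i j h => (hC i j h).1) (fun i j h => (hC i j h).2) (fun i j _ => (hD i j).1)
    (fun i j h => (hD i j).2.trans (if_pos h)) (fun i j h => (hD i j).2.trans (if_neg h.not_gt))
  have hr0 : (0 : ℝ) < r := mod_cast hr
  have hM : q ≤ Fintype.card M := by
    rw [card_square_matrix_zmod]
    exact Nat.le_self_pow (by simp) q
  refine ⟨Fin r × M, inferInstance, ?_, hcov.mono ?_⟩
  · rw [Fintype.card_prod, Fintype.card_fin]
    exact (by omega : N ≤ Fintype.card M).trans (Nat.le_mul_of_pos_left _ hr)
  · have hGL := one_sub_div_mul_le_card_GL (q := q) (m := r + 2)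
    rw [Nat.card_eq_fintype_card, Nat.card_eq_fintype_card] at hGL
    have hGL' : (1 - ((r + 2 : ℕ) : ℝ) / q) * Fintype.card M ≤ Fintype.card Mˣ := hGL
    have hq' : ((r + 2 : ℕ) : ℝ) / q ≤ ε := by
      have h1 : ((r : ℝ) + 2) / ε ≤ q :=
        (Nat.le_ceil _).trans (Nat.cast_le.2 (by omega))
      have hq0 : (0 : ℝ) < q := mod_cast hq.pos
      rw [div_le_iff₀ hε] at h1
      rw [div_le_iff₀ hq0]
      push_cast
      linarith
    have h2 : (Fintype.card M : ℝ) - Fintype.card Mˣ ≤ ε * Fintype.card M := by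
      have := mul_le_mul_of_nonneg_right hq' (Nat.cast_nonneg (α := ℝ) (Fintype.card M))
      linarith
    rw [Fintype.card_prod, Fintype.card_fin]
    push_cast
    calc _ ≤ r * (Fintype.card M : ℝ) ^ 2 + r ^ 2 * Fintype.card M * (ε * Fintype.card M)
          + 2 * (r / (r + 2) * (Fintype.card M : ℝ) ^ 2) := by gcongr
      _ = _ := by
        have : (r : ℝ) + 2 ≠ 0 := by positivity
        field_simp
        try ring

lemma isUnit_natCast_sub_natCast {m t i j : ℕ} (ht : t ≡ 1 [MOD m.factorial]) (hi : i < m)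
    (hj : j < m) (hij : i ≠ j) : IsUnit ((i : ZMod t) - (j : ZMod t)) := by
  wlog h : j < i generalizing i j
  · rw [← neg_sub, IsUnit.neg_iff]
    exact this hj hi hij.symm (by omega)
  rw [← Nat.cast_sub h.le, ZMod.isUnit_iff_coprime]
  have hdvd : i - j ∣ m.factorial := Nat.dvd_factorial (by omega) (by omega)
  have := (ht.of_dvd hdvd).gcd_eq
  rw [Nat.coprime_iff_gcd_eq_one, Nat.gcd_comm, this]
  simp

lemma HasCover.blowup {V : Type} [Fintype V] {k : ℕ} {c : ℝ} (h : HasCover V k c) (t : ℕ)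
    [NeZero t] (ht : t ≡ 1 [MOD (Fintype.card V).factorial]) :
    HasCover (V × ZMod t) k (Fintype.card V * (t : ℝ) ^ 2 + (t : ℝ) ^ 2 * c) := by
  classical
  obtain ⟨H, K, hH, hK, hcov, hc⟩ := h
  let l : V → ZMod t := fun v => ((Fintype.equivFin V v : ℕ) : ZMod t)
  have hl : ∀ u v, u ≠ v → IsUnit (l u - l v) := fun u v huv =>
    isUnit_natCast_sub_natCast ht (Fin.is_lt _) (Fin.is_lt _)
      fun h => huv ((Fintype.equivFin V).injective (Fin.ext h))
  let H' : SimpleGraph (V × ZMod t) :=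
    { Adj := fun p q => (p.1 = q.1 ∧ p.2 ≠ q.2) ∨ H.Adj p.1 q.1
      symm := ⟨by
        rintro ⟨i, a⟩ ⟨j, b⟩ (h | h)
        · exact Or.inl ⟨h.1.symm, h.2.symm⟩
        · exact Or.inr h.symm⟩
      loopless := ⟨by rintro ⟨i, a⟩ (h | h) <;> simp at h⟩ }
  let blk : Finset V × ZMod t × ZMod t → Finset (V × ZMod t) := fun p =>
    p.1.image fun v => (v, p.2.1 + l v * p.2.2)
  refine ⟨H', (K ×ˢ univ).image blk, ?_, ?_, ?_, ?_⟩
  · intro s hs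
    have hinj : Set.InjOn Prod.fst (s : Set (V × ZMod t)) := by
      intro p hp q hq hpq
      by_contra hne
      have := hs.1 hp hq hne
      rw [SimpleGraph.compl_adj] at this
      exact this.2 (Or.inl ⟨hpq, fun h => hne (Prod.ext hpq h)⟩)
    refine hH (s.image Prod.fst) ⟨?_, by rw [card_image_of_injOn hinj, hs.2]⟩
    rw [coe_image]
    rintro _ ⟨p, hp, rfl⟩ _ ⟨q, hq, rfl⟩ hpq
    have := hs.1 hp hq fun h => hpq (congrArg _ h)
    rw [SimpleGraph.compl_adj] at this ⊢
    exact ⟨hpq, fun h => this.2 (Or.inr h)⟩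
  · intro A hA
    obtain ⟨p, hp, rfl⟩ := mem_image.1 hA
    exact card_image_le.trans (hK _ (mem_product.1 hp).1)
  · rintro ⟨u, y⟩ ⟨v, z⟩ hne hadj
    have huv : u ≠ v := by
      rintro rfl
      exact hadj (Or.inl ⟨rfl, fun h => hne (by simpa using h)⟩)
    obtain ⟨A, hA, hu, hv⟩ := hcov u v huv fun h => hadj (Or.inr h)
    obtain ⟨d, hd⟩ := hl u v huv
    have e : (l u - l v) * ((d⁻¹ : (ZMod t)ˣ) * (y - z)) = y - z := by
      rw [← hd, ← mul_assoc, Units.mul_inv, one_mul]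
    set b := (d⁻¹ : (ZMod t)ˣ) * (y - z)
    refine ⟨_, mem_image_of_mem blk (mk_mem_product hA (mem_univ (y - l u * b, b))), ?_, ?_⟩
    · refine mem_image.2 ⟨u, hu, ?_⟩
      simp
    · refine mem_image.2 ⟨v, hv, ?_⟩
      simp only [Prod.mk.injEq, true_and]
      linear_combination -e
  · have h1 : Nat.card {p : (V × ZMod t) × (V × ZMod t) // H'.Adj p.1 p.2} ≤
        Fintype.card V * t ^ 2 + t ^ 2 * Nat.card {p : V × V // H.Adj p.1 p.2} := by
      let f : {p : (V × ZMod t) × (V × ZMod t) // H'.Adj p.1 p.2} →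
          (V × ZMod t × ZMod t) ⊕ ((ZMod t × ZMod t) × {p : V × V // H.Adj p.1 p.2}) := fun p =>
        if h : p.1.1.1 = p.1.2.1 then Sum.inl (p.1.1.1, p.1.1.2, p.1.2.2)
        else Sum.inr ((p.1.1.2, p.1.2.2), ⟨(p.1.1.1, p.1.2.1), by
          rcases p.2 with h' | h'
          exacts [absurd h'.1 h, h']⟩)
      have hf : Function.Injective f := by
        rintro ⟨⟨⟨i, a⟩, ⟨j, b⟩⟩, h⟩ ⟨⟨⟨i', a'⟩, ⟨j', b'⟩⟩, h'⟩ hff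
        simp only [f] at hff
        split_ifs at hff with h1 h2 h2 <;> simp_all
      rw [Nat.card_eq_fintype_card, Nat.card_eq_fintype_card]
      refine (Fintype.card_le_of_injective f hf).trans (le_of_eq ?_)
      simp only [Fintype.card_sum, Fintype.card_prod, ZMod.card]
      ring
    have h2 : #((K ×ˢ univ).image blk) ≤ t ^ 2 * #K := by
      refine card_image_le.trans (le_of_eq ?_)
      simp only [card_product, card_univ, Fintype.card_prod, ZMod.card]
      ring
    have h1' : (Nat.card {p : (V × ZMod t) × (V × ZMod t) // H'.Adj p.1 p.2} : ℝ) ≤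
        Fintype.card V * (t : ℝ) ^ 2 + (t : ℝ) ^ 2 * Nat.card {p : V × V // H.Adj p.1 p.2} :=
      mod_cast h1
    have h2' : (#((K ×ˢ univ).image blk) : ℝ) ≤ (t : ℝ) ^ 2 * #K := mod_cast h2
    have h3 := mul_le_mul_of_nonneg_left hc (sq_nonneg (t : ℝ))
    linarith

lemma HasCover.gamma_le {V : Type} [Fintype V] {k n : ℕ} {c : ℝ} (h : HasCover V k c)
    (hk : k ≤ n) (hn : n ≤ Fintype.card V) : (gamma n k 2 : ℝ) ≤ c / 2 := by
  classical
  obtain ⟨H, K, hH, hK, hcov, hc⟩ := h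
  obtain ⟨φ⟩ := Function.Embedding.nonempty_of_card_le (α := Fin n) (β := V) (by simpa)
  let G := H.comap φ
  let f : Sym2 (Fin n) → Finset ℕ := fun e => e.toFinset.map Fin.valEmbedding
  have hf (i j : Fin n) : f s(i, j) = {(i : ℕ), (j : ℕ)} := by
    ext x; simp [f, eq_comm]
  have hg (A : Finset V) : ∃ B : Finset ℕ, A ∈ K →
      (∀ i : Fin n, φ i ∈ A → (i : ℕ) ∈ B) ∧ B ⊆ range n ∧ #B = k := by
    by_cases hA : A ∈ K
    · obtain ⟨B, h1, h2, h3⟩ := exists_subsuperset_card_eq (n := k)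
        (s := (univ.filter fun i => φ i ∈ A).map Fin.valEmbedding) (t := range n)
        (by intro x; simp; rintro y - rfl; exact y.2) (by
          rw [card_map]
          refine le_trans ?_ (hK A hA)
          exact card_le_card_of_injOn φ (by intro i; simp) φ.injective.injOn) (by simpa)
      refine ⟨B, fun _ => ⟨fun i hi => h1 ?_, h2, h3⟩⟩
      simp only [mem_map, mem_filter, mem_univ, true_and]
      exact ⟨i, hi, rfl⟩
    · exact ⟨∅, fun h => absurd h hA⟩
  choose g hg using hg
  have hdom : IsDomSet n k 2 (G.edgeFinset.image f) (K.image g) := by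
    refine ⟨?_, ?_, ?_, ?_⟩
    · intro e he
      obtain ⟨s, hs, rfl⟩ := mem_image.1 he
      induction s with | _ i j
      rw [hf]
      have hij : i ≠ j := fun h =>
        (show H.Adj (φ i) (φ j) from SimpleGraph.mem_edgeFinset.1 hs).ne (congrArg φ h)
      refine ⟨?_, card_pair fun h => hij (Fin.ext h)⟩
      simp [insert_subset_iff]
    · intro B hB
      obtain ⟨A, hA, rfl⟩ := mem_image.1 hB
      exact (hg A hA).2
    · intro A hAn hAk _
      by_contra! hno
      have hlt : ∀ m ∈ A, m < n := fun m hm => mem_range.1 (hAn hm)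
      refine hH ((A.attachFin hlt).map φ) ⟨?_, by simp [hAk]⟩
      rw [coe_map]
      rintro _ ⟨i, hi, rfl⟩ _ ⟨j, hj, rfl⟩ hij
      rw [SimpleGraph.compl_adj]
      refine ⟨hij, fun hadj => hno (f s(i, j)) (mem_image_of_mem _ ?_) ?_⟩
      · rw [SimpleGraph.mem_edgeFinset]
        exact hadj
      · rw [hf, insert_subset_iff, singleton_subset_iff]
        exact ⟨mem_attachFin hlt |>.1 hi, mem_attachFin hlt |>.1 hj⟩
    · intro e hen he2 heE
      obtain ⟨x, y, hxy, rfl⟩ := card_eq_two.1 he2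
      simp only [insert_subset_iff, singleton_subset_iff, mem_range] at hen
      obtain ⟨A, hA, h1, h2⟩ := hcov (φ ⟨x, hen.1⟩) (φ ⟨y, hen.2⟩)
        (fun h => hxy (by simpa using φ.injective h)) (fun hadj => heE (by
          refine mem_image.2 ⟨s(⟨x, hen.1⟩, ⟨y, hen.2⟩), ?_, hf _ _⟩
          rw [SimpleGraph.mem_edgeFinset]
          exact hadj))
      refine ⟨g A, mem_image_of_mem _ hA, ?_⟩
      rw [insert_subset_iff, singleton_subset_iff]
      exact ⟨(hg A hA).1 _ h1, (hg A hA).1 _ h2⟩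
  have h1 : gamma n k 2 ≤ #(G.edgeFinset.image f) + #(K.image g) :=
    Nat.sInf_le ⟨_, _, hdom, rfl⟩
  have h2 : 2 * #G.edgeFinset ≤ Nat.card {p : V × V // H.Adj p.1 p.2} := by
    rw [SimpleGraph.two_mul_card_edgeFinset, ← Fintype.card_subtype, Nat.card_eq_fintype_card]
    exact Fintype.card_le_of_injective
      (fun p => ⟨(φ p.1.1, φ p.1.2), p.2⟩) fun p q hpq => by
        obtain ⟨h1, h2⟩ := Prod.mk.inj (congrArg Subtype.val hpq)
        exact Subtype.ext (Prod.ext (φ.injective h1) (φ.injective h2))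
  have h3 : 2 * gamma n k 2 ≤ Nat.card {p : V × V // H.Adj p.1 p.2} + 2 * #K := by
    have := card_image_le (s := G.edgeFinset) (f := f)
    have := card_image_le (s := K) (f := g)
    omega
  have h3' : 2 * (gamma n k 2 : ℝ) ≤ Nat.card {p : V × V // H.Adj p.1 p.2} + 2 * #K := mod_cast h3
  linarith

lemma gamma_le_of_large {k : ℕ} (hk : 2 ≤ k) {ε : ℝ} (hε : 0 < ε) :
    ∃ N : ℕ, ∀ n, N ≤ n → (gamma n k 2 : ℝ) ≤
      (((k : ℝ) + 3) / (2 * ((k : ℝ) - 1) * ((k : ℝ) + 1)) + ε) * (n : ℝ) ^ 2 := by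
  obtain ⟨r, rfl⟩ : ∃ r, k = r + 1 := ⟨k - 1, by omega⟩
  have hr : 1 ≤ r := by omega
  have hr0 : (0 : ℝ) < r := mod_cast hr
  obtain ⟨V, _, hV, hcov⟩ := exists_hasCover_large hr (half_pos hε) (⌈2 / ε⌉₊ + 1)
  set s := Fintype.card V
  set c : ℝ := ((r + 1 : ℕ) + 3) / (2 * (((r + 1 : ℕ) : ℝ) - 1) * ((r + 1 : ℕ) + 1)) with hc
  have hc2 : 1 / (r : ℝ) + 2 / (r * (r + 2)) = 2 * c := by
    rw [hc]; push_cast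
    have : (r : ℝ) + 1 + 1 ≠ 0 := by positivity
    have : (r : ℝ) + 2 ≠ 0 := by positivity
    have h : (r : ℝ) + 1 - 1 = r := by ring
    rw [h]
    field_simp
    ring
  have hc0 : 0 < c := by
    have : 0 < 1 / (r : ℝ) + 2 / (r * (r + 2)) := by positivity
    linarith
  rw [hc2] at hcov
  have hs0 : 0 < s := by omega
  let L := s + s * s.factorial
  refine ⟨max (max L (r + 1)) ⌈3 * L * (c + ε / 2) / (ε / 2)⌉₊, fun n hn => ?_⟩
  have hnL : L ≤ n := (le_max_left _ _).trans ((le_max_left _ _).trans hn)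
  have hnr : r + 1 ≤ n := (le_max_right _ _).trans ((le_max_left _ _).trans hn)
  have hn3 : 3 * L * (c + ε / 2) / (ε / 2) ≤ n :=
    (Nat.le_ceil _).trans (Nat.cast_le.2 ((le_max_right _ _).trans hn))
  let t := 1 + s.factorial * (n / (s * s.factorial) + 1)
  have : NeZero t := ⟨by simp [t]⟩
  have ht : t ≡ 1 [MOD s.factorial] := by simp [t, Nat.ModEq, Nat.add_mod]
  have hpos : 0 < s * s.factorial := Nat.mul_pos hs0 (Nat.factorial_pos _)
  have hst : s * t = s + s * s.factorial * (n / (s * s.factorial)) + s * s.factorial := by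
    simp only [t]; ring
  have h1 : n ≤ s * t := by
    have := Nat.div_add_mod n (s * s.factorial)
    have := Nat.mod_lt n hpos
    omega
  have h2 : s * t ≤ n + L := by
    have := Nat.mul_div_le n (s * s.factorial)
    omega
  have hg := (hcov.blowup t ht).gamma_le (n := n) hnr (by
    rw [Fintype.card_prod, ZMod.card]; exact h1)
  have hs : (1 : ℝ) ≤ ε / 2 * s := by
    have h : 2 / ε ≤ s := (Nat.le_ceil _).trans (Nat.cast_le.2 (by omega))
    rw [div_le_iff₀ hε] at h
    linarith
  have h2' : (s : ℝ) * t ≤ n + L := mod_cast h2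
  have hnL' : (L : ℝ) ≤ n := mod_cast hnL
  rw [div_le_iff₀ (by positivity)] at hn3
  have hL0 : (0 : ℝ) ≤ L := Nat.cast_nonneg _
  have hn0 : (0 : ℝ) ≤ n := Nat.cast_nonneg _
  calc (gamma n (r + 1) 2 : ℝ)
      ≤ (s * (t : ℝ) ^ 2 + (t : ℝ) ^ 2 * ((2 * c + ε / 2) * (s : ℝ) ^ 2)) / 2 := hg
    _ ≤ (ε / 2 * s * (s * (t : ℝ) ^ 2) + (t : ℝ) ^ 2 * ((2 * c + ε / 2) * (s : ℝ) ^ 2)) / 2 := by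
      have : (0 : ℝ) ≤ s * (t : ℝ) ^ 2 := by positivity
      nlinarith
    _ = (c + ε / 2) * (s * t : ℝ) ^ 2 := by ring
    _ ≤ (c + ε / 2) * (n + L : ℝ) ^ 2 := by gcongr
    _ ≤ (c + ε / 2) * ((n : ℝ) ^ 2 + 3 * L * n) := by
      gcongr
      nlinarith
    _ ≤ (c + ε) * (n : ℝ) ^ 2 := by nlinarith

/-- The `k`-tuples of pairwise adjacent vertices whose `i`-th entry lies in `V i`. -/
noncomputable def cliqueTuples {α : Type*} (G : SimpleGraph α) {k : ℕ} (V : Fin k → Finset α) :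
    Finset (Fin k → α) := by
  classical exact {f ∈ Fintype.piFinset V | ∀ i j, i ≠ j → G.Adj (f i) (f j)}

lemma mem_cliqueTuples {α : Type*} {G : SimpleGraph α} {k : ℕ} {V : Fin k → Finset α}
    {f : Fin k → α} :
    f ∈ cliqueTuples G V ↔ (∀ i, f i ∈ V i) ∧ ∀ i j, i ≠ j → G.Adj (f i) (f j) := by
  simp [cliqueTuples]

/-- Few vertices of `S` have fewer than `δ #T` neighbours in `T`. -/
lemma card_low_degree_lt {α : Type*} {G : SimpleGraph α} [DecidableRel G.Adj] {S T : Finset α}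
    {ε δ : ℝ} (hε : 0 < ε) (hS : S.Nonempty)
    (h : ∀ A ⊆ S, ε * #S ≤ #A → δ * #A * #T ≤ #(G.interedges A T)) :
    (#{v ∈ S | (#{w ∈ T | G.Adj v w} : ℝ) < δ * #T} : ℝ) < ε * #S := by
  by_contra! hle
  set A := {v ∈ S | (#{w ∈ T | G.Adj v w} : ℝ) < δ * #T} with hA
  have hAne : A.Nonempty := by
    rw [← card_pos, ← Nat.cast_pos (α := ℝ)]
    have : (0 : ℝ) < #S := by exact_mod_cast hS.card_pos
    exact lt_of_lt_of_le (by positivity) hle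
  have h1 := h A (filter_subset _ _) hle
  have h2 : (#(G.interedges A T) : ℝ) = ∑ v ∈ A, (#{w ∈ T | G.Adj v w} : ℝ) := by
    rw [SimpleGraph.interedges, Rel.interedges, card_filter, sum_product]
    push_cast [card_filter]
    rfl
  have h3 : ∑ v ∈ A, (#{w ∈ T | G.Adj v w} : ℝ) < ∑ v ∈ A, δ * #T :=
    sum_lt_sum_of_nonempty hAne fun v hv ↦ (mem_filter.1 hv).2
  rw [sum_const, nsmul_eq_mul] at h3
  nlinarith

/-- A one-sided counting lemma: vertex classes that are hereditarily dense to each other span a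
positive proportion of the possible cliques. -/
lemma exists_le_card_cliqueTuples {δ : ℝ} (hδ : 0 < δ) (k : ℕ) :
    ∃ ε : ℝ, 0 < ε ∧ ∃ c : ℝ, 0 < c ∧ ∀ (α : Type) (G : SimpleGraph α) [DecidableRel G.Adj]
      (V : Fin k → Finset α),
      (∀ i j, i ≠ j → ∀ A ⊆ V i, ∀ B ⊆ V j, ε * #(V i) ≤ #A → ε * #(V j) ≤ #B →
        δ * #A * #B ≤ #(G.interedges A B)) →
      c * ∏ i, (#(V i) : ℝ) ≤ #(cliqueTuples G V) := by
  classical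
  induction k with
  | zero =>
    refine ⟨1, one_pos, 1, one_pos, fun α G _ V _ ↦ ?_⟩
    have : (fun i ↦ i.elim0 : Fin 0 → α) ∈ cliqueTuples G V :=
      mem_cliqueTuples.2 ⟨fun i ↦ i.elim0, fun i ↦ i.elim0⟩
    have := card_pos.2 ⟨_, this⟩
    simpa using this
  | succ k ih =>
    obtain ⟨ε₀, hε₀, c₀, hc₀, ih⟩ := ih
    obtain ⟨ε, hε, hε1, hε2⟩ : ∃ ε : ℝ, 0 < ε ∧ ε ≤ δ * ε₀ ∧ ε ≤ 1 / (2 * (k + 1)) :=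
      ⟨min (δ * ε₀) (1 / (2 * (k + 1))), by positivity, min_le_left _ _, min_le_right _ _⟩
    have hkε : (k + 1) * ε ≤ 1 / 2 := by
      rw [le_div_iff₀ (by positivity)] at hε2
      linarith
    have hε_le : ε ≤ 1 := by
      have : (0 : ℝ) ≤ k := by positivity
      nlinarith
    refine ⟨ε, hε, 1 / 2 * (c₀ * δ ^ k), by positivity, fun α G _ V hV ↦ ?_⟩
    rw [Fin.prod_univ_succ]
    obtain h0 | h0 := (V 0).eq_empty_or_nonempty
    · simp [h0]
    set bad : Fin k → Finset α := fun i ↦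
      {v ∈ V 0 | (#{w ∈ V i.succ | G.Adj v w} : ℝ) < δ * #(V i.succ)} with hbad
    have hbad_lt (i) : (#(bad i) : ℝ) < ε * #(V 0) := by
      refine card_low_degree_lt hε h0 fun A hA hA' ↦ ?_
      refine hV 0 i.succ (Fin.succ_ne_zero i).symm A hA _ subset_rfl hA' ?_
      exact mul_le_of_le_one_left (by positivity) hε_le
    set good := V 0 \ univ.biUnion bad with hgood
    have hgood_card : 1 / 2 * (#(V 0) : ℝ) ≤ #good := by
      have h1 : (#(univ.biUnion bad) : ℝ) ≤ k * (ε * #(V 0)) := by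
        calc (#(univ.biUnion bad) : ℝ) ≤ ∑ i, (#(bad i) : ℝ) := mod_cast card_biUnion_le
          _ ≤ ∑ _i : Fin k, ε * #(V 0) := sum_le_sum fun i _ ↦ (hbad_lt i).le
          _ = _ := by simp
      have h2 : (#(V 0) : ℝ) ≤ #good + #(univ.biUnion bad) := by
        exact_mod_cast (tsub_le_iff_right.1 (le_card_sdiff (univ.biUnion bad) (V 0)))
      have : (0 : ℝ) ≤ #(V 0) := by positivity
      nlinarith
    let W (v : α) (i : Fin k) : Finset α := {w ∈ V i.succ | G.Adj v w}
    have hW {v} (hv : v ∈ good) (i) : δ * #(V i.succ) ≤ #(W v i) := by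
      by_contra! hlt
      rw [hgood, mem_sdiff, mem_biUnion] at hv
      exact hv.2 ⟨i, mem_univ _, mem_filter.2 ⟨hv.1, hlt⟩⟩
    have hcount {v} (hv : v ∈ good) :
        c₀ * δ ^ k * ∏ i : Fin k, (#(V i.succ) : ℝ) ≤ #(cliqueTuples G (W v)) := by
      have h1 : ∏ i : Fin k, (δ * #(V i.succ) : ℝ) ≤ ∏ i, (#(W v i) : ℝ) :=
        prod_le_prod (fun i _ ↦ by positivity) fun i _ ↦ hW hv i
      rw [prod_mul_distrib, prod_const, card_univ, Fintype.card_fin] at h1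
      refine le_trans (by rw [mul_assoc]; gcongr) (ih α G (W v) fun i j hij A hA B hB hA' hB' ↦ ?_)
      have key (i) : ε * #(V i.succ) ≤ ε₀ * #(W v i) := by
        have := hW hv i
        have h0 : (0 : ℝ) ≤ #(V i.succ) := by positivity
        nlinarith
      exact hV i.succ j.succ (by simpa using hij) A (hA.trans (filter_subset _ _)) B
        (hB.trans (filter_subset _ _)) ((key i).trans hA') ((key j).trans hB')
    have hinj : #(good.sigma fun v ↦ cliqueTuples G (W v)) ≤ #(cliqueTuples G V) := by
      refine card_le_card_of_injOn (fun p ↦ (Fin.cons p.1 p.2 : Fin (k + 1) → α)) ?_ ?_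
      · rintro ⟨v, f⟩ hvf
        simp only [coe_sigma, Set.mem_sigma_iff, mem_coe, mem_cliqueTuples] at hvf ⊢
        obtain ⟨hv, hf, hadj⟩ := hvf
        have hadj' (i) : G.Adj v (f i) := (mem_filter.1 (hf i)).2
        refine ⟨fun i ↦ ?_, fun i j hij ↦ ?_⟩
        · refine Fin.cases ?_ (fun i ↦ ?_) i
          · exact (mem_sdiff.1 hv).1
          · exact (mem_filter.1 (hf i)).1
        · revert hij
          refine Fin.cases ?_ (fun i ↦ ?_) i <;> refine Fin.cases ?_ (fun j ↦ ?_) j <;> intro hij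
          · exact absurd rfl hij
          · simpa using hadj' j
          · simpa using (hadj' i).symm
          · simpa using hadj i j (by simpa using hij)
      · rintro ⟨v, f⟩ - ⟨w, g⟩ - h
        obtain ⟨rfl, rfl⟩ := Fin.cons_injective2 h
        rfl
    rw [card_sigma] at hinj
    have hprod : 0 ≤ c₀ * δ ^ k * ∏ i : Fin k, (#(V i.succ) : ℝ) :=
      mul_nonneg (by positivity) (prod_nonneg fun i _ ↦ Nat.cast_nonneg _)
    have hsum := sum_le_sum fun v hv ↦ hcount (v := v) hv
    rw [sum_const, nsmul_eq_mul] at hsum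
    have hmul := mul_le_mul_of_nonneg_right hgood_card hprod
    have hinj' : ∑ v ∈ good, (#(cliqueTuples G (W v)) : ℝ) ≤ #(cliqueTuples G V) := mod_cast hinj
    linarith

open SimpleGraph SzemerediRegularity in
lemma card_unreduced_edges_le {α : Type*} [DecidableEq α] [Fintype α] [Nonempty α]
    {G : SimpleGraph α} [DecidableRel G.Adj] {P : Finpartition (univ : Finset α)}
    {ε δ η : ℝ} (hε : 0 < ε) (hδ : 0 ≤ δ) (hη : 0 < η) (hP : P.IsEquipartition)
    (hPε : P.IsUniform G ε) (hP' : 4 / η ≤ #P.parts) :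
    2 * (#G.edgeFinset - #(G.regularityReduced P ε δ).edgeFinset : ℝ)
      ≤ (4 * ε + η / 2 + 4 * δ) * (Fintype.card α : ℝ) ^ 2 := by
  let A := (P.nonUniforms G ε).biUnion fun (U, V) ↦ U ×ˢ V
  let B := P.parts.biUnion offDiag
  let C := (P.sparsePairs G δ).biUnion fun (U, V) ↦ G.interedges U V
  have hsub : (univ ×ˢ univ : Finset (α × α)).filter (fun (x, y) ↦
      G.Adj x y ∧ ¬ (G.regularityReduced P ε δ).Adj x y) ⊆ A ∪ B ∪ C := by
    rintro ⟨x, y⟩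
    simp only [A, B, C, mem_filter, regularityReduced_adj, not_and, not_exists,
      not_le, mem_biUnion, mem_union, mem_product, Prod.exists, mem_offDiag, and_imp,
      or_assoc, and_assoc, P.mk_mem_nonUniforms, Finpartition.mk_mem_sparsePairs,
      mem_interedges_iff]
    intro hx hy h h'
    replace h' := h' h
    obtain ⟨U, hU, hx⟩ := P.exists_mem hx
    obtain ⟨V, hV, hy⟩ := P.exists_mem hy
    obtain rfl | hUV := eq_or_ne U V
    · exact Or.inr (Or.inl ⟨U, hU, hx, hy, G.ne_of_adj h⟩)
    by_cases h₂ : G.IsUniform ε U V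
    · exact Or.inr <| Or.inr ⟨U, V, hU, hV, hUV, h' _ hU _ hV hx hy hUV h₂, hx, hy, h⟩
    · exact Or.inl ⟨U, V, hU, hV, hUV, h₂, hx, hy⟩
  have hA : (#A : ℝ) < 4 * ε * #(univ : Finset α) ^ 2 :=
    hP.sum_nonUniforms_lt univ_nonempty hε hPε
  have hB : (#B : ℝ) ≤ η / 2 * #(univ : Finset α) ^ 2 := hP.card_biUnion_offDiag_le hη hP'
  have hC : (#C : ℝ) ≤ 4 * δ * #(univ : Finset α) ^ 2 :=
    hP.card_interedges_sparsePairs_le (G := G) (ε := δ) hδ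
  rw [card_univ] at hA hB hC
  calc
    _ = (#((univ ×ˢ univ).filter fun (x, y) ↦
          G.Adj x y ∧ ¬(G.regularityReduced P ε δ).Adj x y) : ℝ) := by
      rw [univ_product_univ, mul_sub, filter_and_not, cast_card_sdiff]
      · norm_cast
        rw [two_mul_card_edgeFinset, two_mul_card_edgeFinset]
      · gcongr with xy _
        exact fun hxy ↦ regularityReduced_le hxy
    _ ≤ #(A ∪ B ∪ C) := by gcongr
    _ ≤ #(A ∪ B) + #C := mod_cast (card_union_le _ _)
    _ ≤ #A + #B + #C := by gcongr; exact mod_cast card_union_le _ _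
    _ ≤ _ := by linarith

lemma card_div_le_card_part {α : Type*} [DecidableEq α] [Fintype α]
    {P : Finpartition (univ : Finset α)} (hP : P.IsEquipartition) {b : ℕ} (hb : #P.parts ≤ b)
    {s : Finset α} (hs : s ∈ P.parts) : (Fintype.card α : ℝ) / (2 * b) ≤ #s := by
  have hpos : 0 < #P.parts := card_pos.2 ⟨_, hs⟩
  have hle : #P.parts ≤ Fintype.card α := P.card_parts_le_card
  have h1 : Fintype.card α ≤ 2 * #P.parts * (Fintype.card α / #P.parts) := by
    have h2 := Nat.div_add_mod (Fintype.card α) #P.parts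
    have h3 := Nat.mod_lt (Fintype.card α) hpos
    have h4 : 1 ≤ Fintype.card α / #P.parts := (Nat.one_le_div_iff hpos).2 hle
    nlinarith
  have h2 : Fintype.card α / #P.parts ≤ #s := hP.average_le_card_part hs
  have h3 : Fintype.card α ≤ 2 * b * #s := h1.trans (by gcongr)
  have hb' : (0 : ℝ) < b := by exact_mod_cast hpos.trans_le hb
  rw [div_le_iff₀ (by positivity)]
  have : (Fintype.card α : ℝ) ≤ 2 * b * #s := by exact_mod_cast h3
  linarith

lemma card_cliqueTuples_le {α : Type} [DecidableEq α] [Fintype α] {G : SimpleGraph α}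
    [DecidableRel G.Adj] {k : ℕ} {V : Fin k → Finset α}
    (hV : ∀ i j, i ≠ j → Disjoint (V i) (V j)) :
    #(cliqueTuples G V) ≤ #(G.cliqueFinset k) := by
  have hinj {f} (hf : f ∈ cliqueTuples G V) : Function.Injective f := fun i j hij ↦ by
    by_contra hne
    exact (((mem_cliqueTuples.1 hf).2 i j hne).ne hij)
  refine card_le_card_of_injOn (fun f ↦ univ.image f) (fun f hf ↦ ?_) (fun f hf g hg h ↦ ?_)
  · rw [mem_coe] at hf ⊢
    rw [SimpleGraph.mem_cliqueFinset_iff, SimpleGraph.isNClique_iff,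
      card_image_of_injective _ (hinj hf), card_univ, Fintype.card_fin]
    refine ⟨fun x hx y hy hxy ↦ ?_, rfl⟩
    simp only [coe_image, coe_univ, Set.image_univ, Set.mem_range] at hx hy
    obtain ⟨i, rfl⟩ := hx
    obtain ⟨j, rfl⟩ := hy
    exact (mem_cliqueTuples.1 hf).2 i j fun h ↦ hxy (by rw [h])
  · rw [mem_coe] at hf hg
    funext i
    have : f i ∈ univ.image g := by
      have h' : univ.image f = univ.image g := h
      exact h' ▸ mem_image_of_mem f (mem_univ i)
    obtain ⟨j, -, hj⟩ := mem_image.1 this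
    obtain rfl | hij := eq_or_ne i j
    · exact hj.symm
    · exact absurd rfl (disjoint_iff_ne.1 (hV i j hij) _ ((mem_cliqueTuples.1 hf).1 i) _
        (hj ▸ (mem_cliqueTuples.1 hg).1 j))

lemma mul_le_card_interedges_of_isUniform {α : Type*} {G : SimpleGraph α} [DecidableRel G.Adj]
    {U V A B : Finset α} {ε δ : ℝ} (hU : G.IsUniform ε U V) (hd : δ ≤ G.edgeDensity U V)
    (hA : A ⊆ U) (hB : B ⊆ V) (hA' : ε * #U ≤ #A) (hB' : ε * #V ≤ #B) :
    (δ - ε) * #A * #B ≤ #(G.interedges A B) := by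
  have h := hU hA hB (by linarith) (by linarith)
  obtain rfl | hAne := A.eq_empty_or_nonempty
  · simp
  obtain rfl | hBne := B.eq_empty_or_nonempty
  · simp
  have h1 : (G.edgeDensity A B : ℝ) = #(G.interedges A B) / (#A * #B) := by
    rw [SimpleGraph.edgeDensity_def]
    push_cast
    rfl
  have hA0 : (0 : ℝ) < #A := by exact_mod_cast hAne.card_pos
  have hB0 : (0 : ℝ) < #B := by exact_mod_cast hBne.card_pos
  have h2 : δ - ε ≤ #(G.interedges A B) / (#A * #B) := by
    rw [← h1]
    have := (abs_lt.1 h).1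
    linarith
  rwa [le_div_iff₀ (by positivity), ← mul_assoc] at h2

open SimpleGraph SzemerediRegularity in
lemma exists_cliqueFree_of_card_cliqueFinset_le {k : ℕ} (hk : 3 ≤ k) {ε : ℝ} (hε : 0 < ε) :
    ∃ N : ℕ, ∀ n, N ≤ n → ∀ (G : SimpleGraph (Fin n)) [DecidableRel G.Adj],
      #(G.cliqueFinset k) ≤ n ^ 2 → ∃ G' ≤ G, G'.CliqueFree k ∧ ∃ _ : DecidableRel G'.Adj,
        (#G.edgeFinset : ℝ) - #G'.edgeFinset ≤ ε * (n : ℝ) ^ 2 := by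
  classical
  set δ := ε / 8 with hδ
  obtain ⟨ε₀, hε₀, c, hc, hcount⟩ := exists_le_card_cliqueTuples (δ := δ / 2) (by positivity) k
  obtain ⟨ε', hε', hε'1, hε'2⟩ : ∃ ε' : ℝ, 0 < ε' ∧ ε' ≤ ε₀ ∧ ε' ≤ δ / 2 :=
    ⟨min ε₀ (δ / 2), by positivity, min_le_left _ _, min_le_right _ _⟩
  set l := ⌈4 / ε⌉₊ with hl
  set b := bound ε' l with hb
  have hb0 : 0 < b := bound_pos _ _
  have hb0' : (0 : ℝ) < b := by exact_mod_cast hb0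
  refine ⟨max (l + 1) (max (2 * b) (⌈8 * (b : ℝ) ^ 3 / c⌉₊ + 1)), fun n hn G _ hG ↦ ?_⟩
  simp only [max_le_iff] at hn
  obtain ⟨hn1, hn2, hn3⟩ := hn
  have : Nonempty (Fin n) := ⟨⟨0, by omega⟩⟩
  have hn0 : (0 : ℝ) < n := by exact_mod_cast (by omega : 0 < n)
  obtain ⟨P, hP₁, hP₂, hP₃, hP₄⟩ := szemeredi_regularity G hε' (l := l) (by simp; omega)
  refine ⟨G.regularityReduced P ε' δ, regularityReduced_le, ?_, inferInstance, ?_⟩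
  · by_contra hfree
    rw [SimpleGraph.not_cliqueFree_iff_top_isContained] at hfree
    obtain ⟨φ⟩ := hfree
    have hparts (i j : Fin k) (hij : i ≠ j) : P.part (φ i) ≠ P.part (φ j) ∧
        G.IsUniform ε' (P.part (φ i)) (P.part (φ j)) ∧
        δ ≤ G.edgeDensity (P.part (φ i)) (P.part (φ j)) := by
      have hadj : (G.regularityReduced P ε' δ).Adj (φ i) (φ j) := φ.toHom.map_adj (by simpa using hij)
      obtain ⟨-, U, hU, V, hV, hiU, hjV, hUV, hunif, hdens⟩ := hadj
      rw [P.part_eq_of_mem hU hiU, P.part_eq_of_mem hV hjV]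
      exact ⟨hUV, hunif, hdens⟩
    have hmem (i : Fin k) : P.part (φ i) ∈ P.parts := P.part_mem.2 (mem_univ _)
    have h1 := hcount (Fin n) G (fun i ↦ P.part (φ i)) fun i j hij A hA B hB hA' hB' ↦ by
      obtain ⟨-, hunif, hdens⟩ := hparts i j hij
      refine le_trans ?_ (mul_le_card_interedges_of_isUniform hunif hdens hA hB
        (le_trans (by gcongr) hA') (le_trans (by gcongr) hB'))
      gcongr
      linarith
    have h2 : #(cliqueTuples G fun i ↦ P.part (φ i)) ≤ n ^ 2 :=
      (card_cliqueTuples_le fun i j hij ↦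
        P.disjoint (hmem i) (hmem j) (hparts i j hij).1).trans hG
    have h3 : ((n : ℝ) / (2 * b)) ^ k ≤ ∏ i, (#(P.part (φ i)) : ℝ) := by
      calc ((n : ℝ) / (2 * b)) ^ k = ∏ _i : Fin k, (n : ℝ) / (2 * b) := by
            rw [prod_const, card_univ, Fintype.card_fin]
        _ ≤ _ := prod_le_prod (fun i _ ↦ by positivity) fun i _ ↦ by
          simpa using card_div_le_card_part hP₁ hP₃ (hmem i)
    have h4 : ((n : ℝ) / (2 * b)) ^ 3 ≤ ((n : ℝ) / (2 * b)) ^ k := by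
      refine pow_le_pow_right₀ ?_ hk
      rw [one_le_div (by positivity)]
      exact_mod_cast hn2
    have h5 : c * ((n : ℝ) / (2 * b)) ^ 3 ≤ (n : ℝ) ^ 2 := by
      calc c * ((n : ℝ) / (2 * b)) ^ 3 ≤ c * ∏ i, (#(P.part (φ i)) : ℝ) := by
            gcongr; exact h4.trans h3
        _ ≤ _ := h1
        _ ≤ _ := by exact_mod_cast h2
    have h6 : 8 * (b : ℝ) ^ 3 / c < n := by
      refine (Nat.le_ceil _).trans_lt ?_
      exact_mod_cast hn3
    rw [div_lt_iff₀ hc] at h6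
    have h7 : c * ((n : ℝ) / (2 * b)) ^ 3 = (n * c) * (n : ℝ) ^ 2 / (8 * b ^ 3) := by
      field_simp
      ring
    rw [h7, div_le_iff₀ (by positivity)] at h5
    have : (0 : ℝ) < (n : ℝ) ^ 2 := by positivity
    nlinarith
  · have h := card_unreduced_edges_le (G := G) hε' (δ := δ) (by positivity) hε hP₁ hP₄
      ((Nat.le_ceil _).trans (by exact_mod_cast hP₂))
    rw [Fintype.card_fin] at h
    have : (0 : ℝ) < (n : ℝ) ^ 2 := by positivity
    nlinarith

lemma mul_card_edgeFinset_le_of_cliqueFree {V : Type*} [Fintype V] [DecidableEq V]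
    {G : SimpleGraph V} [DecidableRel G.Adj] {r : ℕ} (hr : 0 < r) (hG : G.CliqueFree (r + 1)) :
    2 * r * #G.edgeFinset ≤ (r - 1) * Fintype.card V ^ 2 := by
  obtain ⟨H, _, hH⟩ := SimpleGraph.exists_isTuranMaximal (V := V) hr
  have h1 : #G.edgeFinset ≤ #H.edgeFinset := by convert! hH.2 hG
  rw [((SimpleGraph.isTuranMaximal_iff_nonempty_iso_turanGraph hr).1 hH).some.card_edgeFinset_eq]
    at h1
  exact (Nat.mul_le_mul_left _ h1).trans SimpleGraph.mul_card_edgeFinset_turanGraph_le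

/-- The edges of a graph on `Fin n`, as two-element sets of natural numbers. -/
noncomputable def edgePairs {n : ℕ} (G : SimpleGraph (Fin n)) : Finset (Finset ℕ) := by
  classical exact G.edgeFinset.image fun e ↦ e.toFinset.map Fin.valEmbedding

lemma mem_edgePairs {n : ℕ} {G : SimpleGraph (Fin n)} {e : Finset ℕ} :
    e ∈ edgePairs G ↔ ∃ u v : Fin n, G.Adj u v ∧ ({u.1, v.1} : Finset ℕ) = e := by
  simp only [edgePairs, mem_image, SimpleGraph.mem_edgeFinset]
  constructor
  · rintro ⟨e, he, rfl⟩
    induction e with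
    | h u v => exact ⟨u, v, he, by simp [Sym2.toFinset_mk_eq, map_insert]⟩
  · rintro ⟨u, v, huv, rfl⟩
    exact ⟨s(u, v), huv, by simp [Sym2.toFinset_mk_eq, map_insert]⟩

lemma card_edgePairs {n : ℕ} (G : SimpleGraph (Fin n)) [DecidableRel G.Adj] :
    #(edgePairs G) = #G.edgeFinset := by
  classical
  rw [edgePairs, card_image_of_injective]
  · congr!
  · intro e e' h
    have h' := map_injective _ h
    exact Sym2.ext fun x ↦ by rw [← Sym2.mem_toFinset, h', Sym2.mem_toFinset]

lemma exists_eq_pair_of_card_two {n : ℕ} {e : Finset ℕ} (he : e ⊆ range n) (hc : #e = 2) :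
    ∃ u v : Fin n, u ≠ v ∧ ({u.1, v.1} : Finset ℕ) = e := by
  obtain ⟨a, b, hab, rfl⟩ := card_eq_two.1 hc
  have ha : a < n := mem_range.1 (he (by simp))
  have hb : b < n := mem_range.1 (he (by simp))
  exact ⟨⟨a, ha⟩, ⟨b, hb⟩, fun h ↦ hab (congrArg Fin.val h), rfl⟩

/-- The graph of pairs outside `E`. -/
def pairComplement (n : ℕ) (E : Finset (Finset ℕ)) : SimpleGraph (Fin n) where
  Adj u v := u ≠ v ∧ ({u.1, v.1} : Finset ℕ) ∉ E
  symm.symm u v h := ⟨h.1.symm, by rw [pair_comm]; exact h.2⟩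
  loopless.irrefl u h := h.1 rfl

section DominatingSet

variable {n k : ℕ} {E K : Finset (Finset ℕ)}

lemma choose_two_le_card_add (n : ℕ) (E : Finset (Finset ℕ)) :
    n.choose 2 ≤ #E + #(edgePairs (pairComplement n E)) := by
  rw [← card_range n, ← card_powersetCard, card_range]
  refine (card_le_card fun e he ↦ ?_).trans (card_union_le _ _)
  rw [mem_powersetCard] at he
  by_cases heE : e ∈ E
  · exact mem_union_left _ heE
  · obtain ⟨u, v, huv, rfl⟩ := exists_eq_pair_of_card_two he.1 he.2
    exact mem_union_right _ (mem_edgePairs.2 ⟨u, v, ⟨huv, heE⟩, rfl⟩)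

lemma IsDomSet.card_cliqueFinset_le [DecidableRel (pairComplement n E).Adj]
    (h : IsDomSet n k 2 E K) : #((pairComplement n E).cliqueFinset k) ≤ #K := by
  refine card_le_card_of_injOn (fun s ↦ s.map Fin.valEmbedding) (fun s hs ↦ ?_)
    (map_injective _).injOn
  rw [mem_coe, SimpleGraph.mem_cliqueFinset_iff, SimpleGraph.isNClique_iff] at hs
  by_contra hK
  obtain ⟨e, heE, hes⟩ := h.2.2.1 (s.map Fin.valEmbedding)
    (fun x hx ↦ by
      obtain ⟨u, -, rfl⟩ := mem_map.1 hx
      simp) (by rw [card_map, hs.2]) hK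
  obtain ⟨u, v, huv, rfl⟩ := exists_eq_pair_of_card_two (h.1 e heE).1 (h.1 e heE).2
  have hmem {w : Fin n} (hw : w.1 ∈ ({u.1, v.1} : Finset ℕ)) : w ∈ s := by
    obtain ⟨w', hw', hww⟩ := mem_map.1 (hes hw)
    rwa [← Fin.val_injective hww]
  exact (hs.1 (mem_coe.2 (hmem (by simp))) (mem_coe.2 (hmem (by simp))) huv).2 heE

/-- A `k`-set of vertices of a `K_k`-free graph spans at most `k.choose 2 - 1` edges. -/
lemma card_edgePairs_filter_lt {G : SimpleGraph (Fin n)} (hG : G.CliqueFree k) {A : Finset ℕ}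
    (hA : A ⊆ range n) (hk : #A = k) : #{e ∈ edgePairs G | e ⊆ A} < k.choose 2 := by
  rw [← hk, ← card_powersetCard]
  refine card_lt_card ((ssubset_iff_of_subset fun e he ↦ ?_).2 ?_)
  · obtain ⟨he, heA⟩ := mem_filter.1 he
    obtain ⟨u, v, huv, rfl⟩ := mem_edgePairs.1 he
    exact mem_powersetCard.2 ⟨heA, card_pair fun h ↦ huv.ne (Fin.ext h)⟩
  · by_contra! hall
    refine hG ({u : Fin n | u.1 ∈ A}) ?_
    rw [SimpleGraph.isNClique_iff]
    refine ⟨fun u hu v hv huv ↦ ?_, ?_⟩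
    · simp only [coe_filter, mem_univ, true_and, Set.mem_ofPred_eq] at hu hv
      have := hall {u.1, v.1} (mem_powersetCard.2
        ⟨by simp [insert_subset_iff, hu, hv], card_pair fun h ↦ huv (Fin.ext h)⟩)
      obtain ⟨x, y, hxy, he⟩ := mem_edgePairs.1 (mem_filter.1 this).1
      have hx : x.1 ∈ ({u.1, v.1} : Finset ℕ) := he ▸ (by simp)
      have hy : y.1 ∈ ({u.1, v.1} : Finset ℕ) := he ▸ (by simp)
      simp only [mem_insert, mem_singleton, ← Fin.ext_iff] at hx hy
      obtain rfl | rfl := hx <;> obtain rfl | rfl := hy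
      · exact absurd rfl hxy.ne
      · exact hxy
      · exact hxy.symm
      · exact absurd rfl hxy.ne
    · rw [← hk, ← card_map Fin.valEmbedding]
      congr 1
      ext a
      simp only [mem_map, mem_filter, mem_univ, true_and, Fin.valEmbedding_apply]
      exact ⟨fun ⟨u, hu, hua⟩ ↦ hua ▸ hu, fun ha ↦ ⟨⟨a, mem_range.1 (hA ha)⟩, ha, rfl⟩⟩

lemma IsDomSet.card_edgePairs_le (h : IsDomSet n k 2 E K) {G : SimpleGraph (Fin n)}
    (hG : G.CliqueFree k) (hle : G ≤ pairComplement n E) :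
    #(edgePairs G) ≤ #K * (k.choose 2 - 1) := by
  have hsub : edgePairs G ⊆ K.biUnion fun A ↦ {e ∈ edgePairs G | e ⊆ A} := fun e he ↦ by
    obtain ⟨u, v, huv, rfl⟩ := mem_edgePairs.1 he
    obtain ⟨A, hA, heA⟩ := h.2.2.2 {u.1, v.1} (by simp [insert_subset_iff])
      (card_pair fun h ↦ huv.ne (Fin.ext h)) (hle huv).2
    exact mem_biUnion.2 ⟨A, hA, mem_filter.2 ⟨he, heA⟩⟩
  exact (card_le_card hsub).trans (card_biUnion_le_card_mul _ _ _ fun A hA ↦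
    Nat.le_sub_one_of_lt (card_edgePairs_filter_lt hG (h.2.1 A hA).1 (h.2.1 A hA).2))

end DominatingSet

lemma exists_isDomSet_gamma_eq {n k : ℕ} :
    ∃ E K, IsDomSet n k 2 E K ∧ gamma n k 2 = #E + #K := by
  refine Nat.sInf_mem (s := {m | ∃ E K, IsDomSet n k 2 E K ∧ m = #E + #K})
    ⟨_, powersetCard 2 (range n), powersetCard k (range n), ⟨?_, ?_, ?_, ?_⟩, rfl⟩
  · exact fun e he ↦ mem_powersetCard.1 he
  · exact fun e he ↦ mem_powersetCard.1 he
  · exact fun A hA hAk hAK ↦ absurd (mem_powersetCard.2 ⟨hA, hAk⟩) hAK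
  · exact fun e he hek heE ↦ absurd (mem_powersetCard.2 ⟨he, hek⟩) heE

lemma density_le {k : ℝ} (hk : 3 ≤ k) {n e m ε E K : ℝ}
    (hE : n * (n - 1) / 2 ≤ E + e) (hem : e - m ≤ ε * n ^ 2)
    (hK : m ≤ K * (k * (k - 1) / 2 - 1)) (hm : 2 * (k - 1) * m ≤ (k - 2) * n ^ 2) :
    ((k + 3) / (2 * (k - 1) * (k + 1)) - ε) * n ^ 2 - n / 2 ≤ E + K := by
  have h1 : 0 < k - 1 := by linarith
  have h2 : 0 < k - 2 := by linarith
  have h3 : 0 < k + 1 := by linarith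
  have hK' : 2 * m / ((k - 2) * (k + 1)) ≤ K := by
    rw [div_le_iff₀ (by positivity)]
    linarith
  have hm' : (k ^ 2 - k - 4) / ((k - 2) * (k + 1)) * m ≤
      (k ^ 2 - k - 4) / ((k - 2) * (k + 1)) * ((k - 2) * n ^ 2 / (2 * (k - 1))) := by
    have : 0 ≤ k ^ 2 - k - 4 := by nlinarith
    gcongr
    rw [le_div_iff₀ (by positivity)]
    linarith
  have e1 : (k ^ 2 - k - 4) / ((k - 2) * (k + 1)) * m = m - 2 * m / ((k - 2) * (k + 1)) := by
    field_simp
    ring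
  have e2 : (k ^ 2 - k - 4) / ((k - 2) * (k + 1)) * ((k - 2) * n ^ 2 / (2 * (k - 1))) =
      n ^ 2 / 2 - (k + 3) / (2 * (k - 1) * (k + 1)) * n ^ 2 := by
    field_simp
    ring
  rw [e1, e2] at hm'
  linarith

lemma le_gamma_of_large {k : ℕ} (hk : 3 ≤ k) {ε : ℝ} (hε : 0 < ε) :
    ∃ N : ℕ, ∀ n, N ≤ n →
      (((k : ℝ) + 3) / (2 * ((k : ℝ) - 1) * ((k : ℝ) + 1)) - ε) * (n : ℝ) ^ 2 ≤ gamma n k 2 := by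
  classical
  obtain ⟨N, hN⟩ := exists_cliqueFree_of_card_cliqueFinset_le hk (half_pos hε)
  have hk' : (3 : ℝ) ≤ k := by exact_mod_cast hk
  refine ⟨max N ⌈1 / ε⌉₊, fun n hn ↦ ?_⟩
  rw [max_le_iff] at hn
  obtain ⟨E, K, hdom, hγ⟩ := exists_isDomSet_gamma_eq (n := n) (k := k)
  rw [hγ]
  push_cast
  obtain hKn | hKn := le_total (n ^ 2) #K
  · have h1 : ((n : ℝ)) ^ 2 ≤ #K := by exact_mod_cast hKn
    have h2 : ((k : ℝ) + 3) / (2 * ((k : ℝ) - 1) * ((k : ℝ) + 1)) ≤ 1 := by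
      have : (0 : ℝ) < k - 1 := by linarith
      rw [div_le_one (by positivity)]
      nlinarith
    have : (0 : ℝ) ≤ #E := by positivity
    nlinarith [sq_nonneg (n : ℝ)]
  · obtain ⟨G', hle, hfree, _, hrem⟩ :=
      hN n hn.1 (pairComplement n E) (hdom.card_cliqueFinset_le.trans hKn)
    have hE := choose_two_le_card_add n E
    have hK := hdom.card_edgePairs_le hfree hle
    have hm := mul_card_edgeFinset_le_of_cliqueFree (r := k - 1) (by omega)
      (by rwa [Nat.sub_add_cancel (by omega)])
    rw [card_edgePairs] at hE hK
    rw [Fintype.card_fin] at hm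
    have hE' : ((n.choose 2 : ℕ) : ℝ) ≤ #E + #(pairComplement n E).edgeFinset := by
      exact_mod_cast hE
    have hM : 1 ≤ k.choose 2 := Nat.choose_pos (by omega)
    have hK' : (#G'.edgeFinset : ℝ) ≤ #K * ((k.choose 2 : ℕ) - 1 : ℝ) := by
      have := (Nat.cast_le (α := ℝ)).2 hK
      push_cast [Nat.cast_sub hM] at this
      exact this
    have hm' : 2 * ((k : ℝ) - 1) * #G'.edgeFinset ≤ ((k : ℝ) - 2) * (n : ℝ) ^ 2 := by
      have := (Nat.cast_le (α := ℝ)).2 hm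
      rw [Nat.sub_sub] at this
      push_cast [Nat.cast_sub (show 1 ≤ k by omega), Nat.cast_sub (show 1 + 1 ≤ k by omega)] at this
      linarith
    rw [Nat.cast_choose_two] at hE' hK'
    refine le_trans ?_ (density_le hk' hE' hrem hK' hm')
    have h1 : 1 / ε ≤ n := (Nat.le_ceil _).trans (by exact_mod_cast hn.2)
    rw [div_le_iff₀ hε] at h1
    have : (0 : ℝ) ≤ n := by positivity
    nlinarith

/-- For every fixed `k ≥ 3`, `γ(G_{k,2}) = (k+3)/(2(k-1)(k+1)) · n² + o(n²)`
as `n → ∞`; that is, `n ↦ γ(G_{k,2}) - (k+3)/(2(k-1)(k+1)) · n²` is `o(n²)`. -/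
theorem domination_number_Gk2_asymptotic (k : ℕ) (hk : 3 ≤ k) :
    ∀ ε : ℝ, 0 < ε → ∃ N : ℕ, ∀ n : ℕ, N ≤ n →
      |(gamma n k 2 : ℝ) - ((k : ℝ) + 3) / (2 * ((k : ℝ) - 1) * ((k : ℝ) + 1)) * (n : ℝ) ^ 2|
        ≤ ε * (n : ℝ) ^ 2 := by
  intro ε hε
  obtain ⟨N₁, h₁⟩ := gamma_le_of_large (k := k) (by omega) hε
  obtain ⟨N₂, h₂⟩ := le_gamma_of_large hk hε
  refine ⟨max N₁ N₂, fun n hn ↦ abs_le.2 ⟨?_, ?_⟩⟩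
  · linarith [h₂ n (le_of_max_le_right hn)]
  · linarith [h₁ n (le_of_max_le_left hn)]
end

section
/- For every fixed integer k ≥ 3 and every ε > 0, there is an N such that for all n ≥ N, γ(G_{k,2}) ≤ ((k+3)/(2(k−1)(k+1)) + ε) · n². -/
open Classical in
/-- Covering the cross pairs of a complete `r`-partite graph with parts of size `|R|` by sets of
size at most `r + 1` bounds `γ(G_{r+1,2})`. -/
lemma gamma_le_of_cover {R J : Type*} [Fintype R] {r n : ℕ} (hn : r + 1 ≤ n)
    (hcard : n ≤ r * Fintype.card R) (S : Finset J) (B : J → Finset (Fin r × R))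
    (hB : ∀ j ∈ S, (B j).card ≤ r + 1)
    (hcov : ∀ x y : Fin r × R, x.1 ≠ y.1 → ∃ j ∈ S, x ∈ B j ∧ y ∈ B j) :
    gamma n (r + 1) 2 ≤ r * (Fintype.card R).choose 2 + S.card := by
  obtain ⟨f, hf⟩ : ∃ f : ℕ → Fin r × R, Set.InjOn f (Finset.range n : Set ℕ) := by
    have hle : (Finset.range n).card ≤ (Finset.univ : Finset (Fin r × R)).card := by
      simpa using hcard
    have hne : Nonempty (Fin r × R) := by
      rw [← Fintype.card_pos_iff]
      simp only [Fintype.card_prod, Fintype.card_fin]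
      omega
    have hle' : (Finset.range n : Set ℕ).encard ≤ (Set.univ : Set (Fin r × R)).encard := by
      rw [Set.encard_coe_eq_coe_finsetCard, ← Finset.coe_univ, Set.encard_coe_eq_coe_finsetCard]
      exact_mod_cast hle
    obtain ⟨f, -, hf⟩ := (Finset.finite_toSet _).exists_injOn_of_encard_le hle'
    exact ⟨f, hf⟩
  have hext : ∀ j ∈ S, ∃ A : Finset ℕ, (A ⊆ Finset.range n ∧ A.card = r + 1) ∧
      (Finset.range n).filter (fun x => f x ∈ B j) ⊆ A := by
    intro j hj
    have h1 : ((Finset.range n).filter (fun x => f x ∈ B j)).card ≤ r + 1 := by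
      refine le_trans (Finset.card_le_card_of_injOn f ?_ ?_) (hB j hj)
      · intro x hx
        exact (Finset.mem_filter.mp hx).2
      · exact hf.mono fun x hx => (Finset.mem_filter.mp hx).1
    obtain ⟨A, h2, h3, h4⟩ := Finset.exists_subsuperset_card_eq
      (Finset.filter_subset (fun x => f x ∈ B j) (Finset.range n)) h1 (by simpa using hn)
    exact ⟨A, ⟨h3, h4⟩, h2⟩
  choose! A hA hAB using hext
  set cls : Fin r → Finset ℕ := fun i => (Finset.range n).filter (fun x => (f x).1 = i) with hcls
  set E : Finset (Finset ℕ) := Finset.univ.biUnion fun i => (cls i).powersetCard 2 with hE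
  have hEcard : E.card ≤ r * (Fintype.card R).choose 2 := by
    refine (Finset.card_biUnion_le).trans ?_
    refine (Finset.sum_le_card_nsmul _ _ ((Fintype.card R).choose 2) ?_).trans (by simp)
    intro i _
    rw [Finset.card_powersetCard]
    refine Nat.choose_le_choose 2 ?_
    refine Finset.card_le_card_of_injOn (t := Finset.univ) (fun x => (f x).2) (by simp) ?_
    intro x hx y hy hxy
    have hx := Finset.mem_filter.mp hx
    have hy := Finset.mem_filter.mp hy
    exact hf (by exact_mod_cast hx.1) (by exact_mod_cast hy.1)
      (Prod.ext (hx.2.trans hy.2.symm) hxy)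
  have hmemE : ∀ x ∈ Finset.range n, ∀ y ∈ Finset.range n, x ≠ y → (f x).1 = (f y).1 →
      ({x, y} : Finset ℕ) ∈ E := by
    intro x hx y hy hxy hc
    rw [hE, Finset.mem_biUnion]
    refine ⟨(f x).1, Finset.mem_univ _, Finset.mem_powersetCard.mpr ⟨?_, Finset.card_pair hxy⟩⟩
    intro z hz
    rcases Finset.mem_insert.mp hz with rfl | hz
    · exact Finset.mem_filter.mpr ⟨hx, rfl⟩
    · rw [Finset.mem_singleton.mp hz]
      exact Finset.mem_filter.mpr ⟨hy, hc.symm⟩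
  have hdom : IsDomSet n (r + 1) 2 E (S.image A) := by
    refine ⟨?_, ?_, ?_, ?_⟩
    · intro e he
      obtain ⟨i, -, hi⟩ := Finset.mem_biUnion.mp he
      obtain ⟨h1, h2⟩ := Finset.mem_powersetCard.mp hi
      exact ⟨h1.trans (Finset.filter_subset _ _), h2⟩
    · intro T hT
      obtain ⟨j, hj, rfl⟩ := Finset.mem_image.mp hT
      exact hA j hj
    · intro T hT hTc _
      obtain ⟨x, hx, y, hy, hxy, hc⟩ := Finset.exists_ne_map_eq_of_card_lt_of_maps_to
        (s := T) (t := (Finset.univ : Finset (Fin r))) (f := fun x => (f x).1)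
        (by simp [hTc]) (by simp)
      refine ⟨{x, y}, hmemE x (hT hx) y (hT hy) hxy hc, ?_⟩
      simp [Finset.insert_subset_iff, hx, hy]
    · intro e he hec heE
      obtain ⟨x, y, hxy, rfl⟩ := Finset.card_eq_two.mp hec
      have hx : x ∈ Finset.range n := he (by simp)
      have hy : y ∈ Finset.range n := he (by simp)
      obtain ⟨j, hj, h1, h2⟩ := hcov (f x) (f y) fun hc => heE (hmemE x hx y hy hxy hc)
      refine ⟨A j, Finset.mem_image_of_mem A hj, ?_⟩
      refine Finset.Subset.trans ?_ (hAB j hj)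
      intro z hz
      rcases Finset.mem_insert.mp hz with rfl | hz
      · exact Finset.mem_filter.mpr ⟨hx, h1⟩
      · rw [Finset.mem_singleton.mp hz]
        exact Finset.mem_filter.mpr ⟨hy, h2⟩
  calc gamma n (r + 1) 2 ≤ E.card + (S.image A).card := Nat.sInf_le ⟨E, _, hdom, rfl⟩
    _ ≤ _ := Nat.add_le_add hEcard Finset.card_image_le

/-- The number of residues `v < (r + 2) g + 1` with `v mod (r + 2) < r`, with each of them
taken with the weight of its fibre under a surjection `φ`. -/
lemma card_filter_val_mod_mul_le {R : Type*} [CommRing R] [Fintype R] {r g N : ℕ} [NeZero N]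
    (hN : N = (r + 2) * g + 1) (φ : R →+ ZMod N) (hφ : Function.Surjective φ) :
    (Finset.univ.filter fun a : R => (φ a).val % (r + 2) < r).card * N
      ≤ r * (g + 1) * Fintype.card R := by
  classical
  have hfib : ∀ v : ZMod N, (Finset.univ.filter fun a : R => φ a = v).card
      = (Finset.univ.filter fun a : R => φ a = 0).card := fun v =>
    AddMonoidHom.card_fiber_eq_of_mem_range φ (hφ v) (hφ 0)
  set c := (Finset.univ.filter fun a : R => φ a = 0).card with hc
  have hR : Fintype.card R = N * c := by
    rw [← Finset.card_univ, Finset.card_eq_sum_card_fiberwise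
      (f := φ) (t := Finset.univ) (by simp)]
    simp [hfib, ZMod.card]
  set T : Finset (ZMod N) := Finset.univ.filter fun v => v.val % (r + 2) < r with hT
  have hTc : T.card ≤ r * (g + 1) := by
    have : T.card ≤ (Finset.range r ×ˢ Finset.range (g + 1)).card := by
      refine Finset.card_le_card_of_injOn (fun v => (v.val % (r + 2), v.val / (r + 2))) ?_ ?_
      · intro v hv
        have h1 := (Finset.mem_filter.mp hv).2
        have h2 : v.val < N := ZMod.val_lt v
        have h3 : v.val / (r + 2) < g + 1 := by
          rw [Nat.div_lt_iff_lt_mul (by omega)]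
          nlinarith
        simp [h1, h3]
      · intro v _ w _ hvw
        simp only [Prod.mk.injEq] at hvw
        apply ZMod.val_injective N
        rw [← Nat.div_add_mod v.val (r + 2), ← Nat.div_add_mod w.val (r + 2), hvw.1, hvw.2]
    simpa using this
  have hS : (Finset.univ.filter fun a : R => (φ a).val % (r + 2) < r).card = T.card * c := by
    rw [Finset.card_eq_sum_card_fiberwise (f := φ) (t := T)
      (fun a ha => by simpa [hT] using ha)]
    rw [← smul_eq_mul, ← Finset.sum_const]
    refine Finset.sum_congr rfl fun v hv => ?_
    rw [← hfib v, Finset.filter_filter]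
    congr 1
    ext a
    have := (Finset.mem_filter.mp hv).2
    simp only [Finset.mem_filter, Finset.mem_univ, true_and]
    constructor
    · exact fun h => h.2
    · rintro rfl
      exact ⟨this, rfl⟩
  rw [hS, hR]
  calc T.card * c * N = T.card * (N * c) := by ring
    _ ≤ _ := Nat.mul_le_mul_right _ hTc

/-- The lines `i ↦ a β_i + b` whose slope has `φ(a) mod (r + 2) < r`, each with one additional
point, cover all pairs of points in different parts. -/
lemma gamma_mul_le_of_ring {R : Type*} [CommRing R] [Fintype R] {r g N n : ℕ} [NeZero N]
    (hr : 0 < r) (hn : r + 1 ≤ n) (hcard : n ≤ r * Fintype.card R)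
    (hN : N = (r + 2) * g + 1) (φ : R →+ ZMod N) (hφ : Function.Surjective φ)
    (β : Fin r → R) (hβ : ∀ i j, i ≠ j → IsUnit (β i - β j))
    (hsol : ∀ (i : Fin r) (t : Fin r → ZMod N), ∃ δ : R, ∀ j, j ≠ i → ∀ x : R,
      x * (β i - β j) = δ → φ x = t j) :
    gamma n (r + 1) 2 * N
      ≤ r * (Fintype.card R).choose 2 * N + r * (g + 1) * Fintype.card R ^ 2 := by
  classical
  have hδ : ∀ i : Fin r, ∃ δ : R, ∀ j, j ≠ i → ∀ x : R, x * (β i - β j) = δ →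
      φ x = if i < j then (r : ZMod N) - (i : ℕ) else (r : ZMod N) + 1 - (i : ℕ) := fun i =>
    hsol i fun j => if i < j then (r : ZMod N) - (i : ℕ) else (r : ZMod N) + 1 - (i : ℕ)
  choose δ hδ using hδ
  set kept : Finset R := Finset.univ.filter fun a : R => (φ a).val % (r + 2) < r with hkept
  set ty : R → Fin r := fun a => if h : (φ a).val % (r + 2) < r then ⟨_, h⟩ else ⟨0, hr⟩ with hty
  set B : R × R → Finset (Fin r × R) := fun p =>
    insert (ty p.1, p.1 * β (ty p.1) + p.2 + δ (ty p.1))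
      (Finset.univ.image fun i : Fin r => (i, p.1 * β i + p.2)) with hB
  have hline : ∀ p i, (i, p.1 * β i + p.2) ∈ B p := fun p i =>
    Finset.mem_insert_of_mem (Finset.mem_image_of_mem _ (Finset.mem_univ i))
  have hext : ∀ (i j : Fin r) (a x y : R), a * (β i - β j) = x - y →
      ∀ v, (φ a).val = v → r ≤ v % (r + 2) → (i < j ∧ v % (r + 2) = r ∨ j < i ∧
        v % (r + 2) = r + 1) → ∃ p ∈ kept ×ˢ Finset.univ, (i, x) ∈ B p ∧ (j, y) ∈ B p := by
    intro i j a x y ha v hv hvr hij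
    have hne : i ≠ j := by
      rintro rfl
      simp at hij
    obtain ⟨u, hu⟩ := hβ i j hne
    set d : R := δ i * (u⁻¹ : Rˣ) with hd
    have hdu : d * (β i - β j) = δ i := by rw [hd, ← hu]; simp
    have hφd := hδ i j hne.symm d hdu
    have hvN : v < N := hv ▸ ZMod.val_lt (φ a)
    have hva : φ a = (v : ZMod N) := by rw [← hv, ZMod.natCast_zmod_val]
    have hdm := Nat.div_add_mod v (r + 2)
    have hmod : ((v : ℕ) : ZMod N) = (((r + 2) * (v / (r + 2)) : ℕ) : ZMod N)
        + ((v % (r + 2) : ℕ) : ZMod N) := by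
      rw [← Nat.cast_add, hdm]
    have hφ0 : φ (a - d) = (((r + 2) * (v / (r + 2)) + i : ℕ) : ZMod N) := by
      rw [map_sub, hφd, hva, hmod]
      rcases hij with ⟨h1, h2⟩ | ⟨h1, h2⟩
      · rw [if_pos h1, h2]
        push_cast
        ring
      · rw [if_neg (not_lt.mpr h1.le), h2]
        push_cast
        ring
    have hi := i.isLt
    have hval : (φ (a - d)).val = (r + 2) * (v / (r + 2)) + i := by
      rw [hφ0]
      exact ZMod.val_cast_of_lt (by omega)
    have hvalmod : (φ (a - d)).val % (r + 2) = i := by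
      rw [hval, Nat.mul_add_mod, Nat.mod_eq_of_lt (by omega)]
    have htyi : ty (a - d) = i := by
      simp only [hty, hvalmod, i.isLt, dif_pos]
    refine ⟨(a - d, y - (a - d) * β j), ?_, ?_, ?_⟩
    · exact Finset.mem_product.mpr
        ⟨Finset.mem_filter.mpr ⟨Finset.mem_univ _, hvalmod ▸ hi⟩, Finset.mem_univ _⟩
    · have : x = (a - d) * β i + (y - (a - d) * β j) + δ i := by
        rw [← hdu]
        linear_combination -ha
      rw [hB]
      simp only [htyi]
      rw [← this]
      exact Finset.mem_insert_self _ _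
    · convert hline (a - d, y - (a - d) * β j) j using 2
      simp
  have hcov : ∀ x y : Fin r × R, x.1 ≠ y.1 →
      ∃ p ∈ kept ×ˢ (Finset.univ : Finset R), x ∈ B p ∧ y ∈ B p := by
    rintro ⟨i, x⟩ ⟨j, y⟩ hij
    obtain ⟨u, hu⟩ := hβ i j hij
    set a : R := (x - y) * (u⁻¹ : Rˣ) with ha
    have hau : a * (β i - β j) = x - y := by rw [ha, ← hu]; simp
    by_cases hk : (φ a).val % (r + 2) < r
    · refine ⟨(a, y - a * β j), by simp [hkept, hk], ?_, ?_⟩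
      · convert hline (a, y - a * β j) i using 2
        linear_combination -hau
      · convert hline (a, y - a * β j) j using 2
        simp
    · have hlt : (φ a).val % (r + 2) < r + 2 := Nat.mod_lt _ (by omega)
      have hau' : a * (β j - β i) = y - x := by linear_combination -hau
      rcases lt_or_gt_of_ne hij with h | h <;>
      rcases (by omega : (φ a).val % (r + 2) = r ∨ (φ a).val % (r + 2) = r + 1) with h' | h'
      · exact hext i j a x y hau _ rfl (by omega) (Or.inl ⟨h, h'⟩)
      · obtain ⟨p, h1, h2, h3⟩ := hext j i a y x hau' _ rfl (by omega) (Or.inr ⟨h, h'⟩)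
        exact ⟨p, h1, h3, h2⟩
      · obtain ⟨p, h1, h2, h3⟩ := hext j i a y x hau' _ rfl (by omega) (Or.inl ⟨h, h'⟩)
        exact ⟨p, h1, h3, h2⟩
      · exact hext i j a x y hau _ rfl (by omega) (Or.inr ⟨h, h'⟩)
  have hBc : ∀ p ∈ kept ×ˢ (Finset.univ : Finset R), (B p).card ≤ r + 1 := by
    intro p _
    refine (Finset.card_insert_le _ _).trans ?_
    have := Finset.card_image_le (s := (Finset.univ : Finset (Fin r)))
      (f := fun i : Fin r => (i, p.1 * β i + p.2))
    simp only [Finset.card_univ, Fintype.card_fin] at this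
    omega
  have hmain := gamma_le_of_cover hn hcard _ B hBc hcov
  rw [Finset.card_product, Finset.card_univ] at hmain
  have hkc : kept.card * N ≤ r * (g + 1) * Fintype.card R :=
    card_filter_val_mod_mul_le hN φ hφ
  calc gamma n (r + 1) 2 * N
      ≤ (r * (Fintype.card R).choose 2 + kept.card * Fintype.card R) * N :=
        Nat.mul_le_mul_right _ hmain
    _ = r * (Fintype.card R).choose 2 * N + (kept.card * N) * Fintype.card R := by ring
    _ ≤ r * (Fintype.card R).choose 2 * N
        + (r * (g + 1) * Fintype.card R) * Fintype.card R := by gcongr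
    _ = _ := by ring

/-- Nonzero integers of absolute value at most `m` are units modulo `m! h + 1`. -/
lemma isUnit_intCast_zmod {m h M : ℕ} (hM : M = m.factorial * h + 1) {x : ℤ} (hx : x ≠ 0)
    (hxm : x.natAbs ≤ m) : IsUnit (x : ZMod M) := by
  have h1 : x.natAbs ∣ m.factorial := Nat.dvd_factorial (by omega) hxm
  obtain ⟨c, hc⟩ : x ∣ (m.factorial : ℤ) := Int.natAbs_dvd.mp (by exact_mod_cast h1)
  refine IsUnit.of_mul_eq_one (-(c * h : ZMod M)) ?_
  have h2 : ((m.factorial * h + 1 : ℕ) : ZMod M) = 0 := by rw [← hM]; simp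
  have h3 : (m.factorial : ZMod M) = x * c := by
    have := congrArg (Int.cast : ℤ → ZMod M) hc
    simpa using this
  push_cast at h2
  rw [h3] at h2
  linear_combination -h2

/-- Evaluation points for the coordinate `e`: the values `0, …, r - 1`, except that the value at
the index `e` is replaced by `-1`. -/
def coordPoint {r : ℕ} (e : Option (Fin r)) (i : Fin r) : ℤ :=
  if e = some i then -1 else ((i : ℕ) : ℤ)

lemma coordPoint_sub_ne_zero {r : ℕ} (e : Option (Fin r)) {i j : Fin r} (hij : i ≠ j) :
    coordPoint e i - coordPoint e j ≠ 0 ∧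
      (coordPoint e i - coordPoint e j).natAbs ≤ r + 2 := by
  have hij' : (i : ℕ) ≠ j := fun h => hij (Fin.ext h)
  have hi := i.isLt
  have hj := j.isLt
  unfold coordPoint
  split_ifs with h1 h2 h2
  · exact absurd (Option.some_injective _ (h1.symm.trans h2)) hij
  all_goals omega

/-- The products `x_e = δ_e / (β_i - β_j)` can be given any prescribed coordinate sums, for all
`j ≠ i` simultaneously, by a suitable choice of `δ`. -/
lemma exists_coord_sum_eq {r h N : ℕ} (hN : N = (r + 2).factorial * h + 1)
    (i : Fin r) (t : Fin r → ZMod N) : ∃ δ : Option (Fin r) → ZMod N, ∀ j, j ≠ i →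
      ∀ x : Option (Fin r) → ZMod N,
        (∀ e, x e * ((coordPoint e i - coordPoint e j : ℤ) : ZMod N) = δ e) →
        ∑ e, x e = t j := by
  have hunit : ∀ z : ℤ, z ≠ 0 → z.natAbs ≤ r + 2 → IsUnit (z : ZMod N) := fun z =>
    isUnit_intCast_zmod hN
  have hw : ∀ e : Fin r, ∃ w : ZMod N,
      w * (-((e : ℕ) + 1 : ℤ) : ℤ) = t e * (((i : ℕ) + 1 : ℤ) : ZMod N)
        * (((i : ℕ) - (e : ℕ) : ℤ) : ZMod N) := by
    intro e
    have he := e.isLt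
    obtain ⟨u, hu⟩ := hunit (-((e : ℕ) + 1 : ℤ)) (by omega) (by omega)
    refine ⟨t e * (((i : ℕ) + 1 : ℤ) : ZMod N) * (((i : ℕ) - (e : ℕ) : ℤ) : ZMod N)
      * (u⁻¹ : (ZMod N)ˣ), ?_⟩
    rw [← hu]
    simp
  choose w hw using hw
  refine ⟨fun e => e.elim (-∑ e ∈ Finset.univ.erase i, w e)
    (fun e => if e = i then 0 else w e), ?_⟩
  intro j hj x hx
  have hi := i.isLt
  have hjl := j.isLt
  have hij : (i : ℕ) ≠ j := fun h => hj (Fin.ext h.symm)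
  have hU := hunit ((i : ℕ) - (j : ℕ) : ℤ) (by omega) (by omega)
  have hV := hunit ((i : ℕ) + 1 : ℤ) (by omega) (by omega)
  have hsum : ∑ e, x e = x none + x (some j) + ∑ e ∈ (Finset.univ.erase i).erase j, x (some e)
      := by
    have h0 : x (some i) = 0 := by
      have h1 := hx (some i)
      simp only [Option.elim, if_true] at h1
      obtain ⟨h2, h3⟩ := coordPoint_sub_ne_zero (some i) hj.symm
      exact (hunit _ h2 h3).mul_left_eq_zero.mp h1
    rw [Fintype.sum_option, ← Finset.add_sum_erase _ _ (Finset.mem_univ i), h0, zero_add,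
      ← Finset.add_sum_erase _ _ (Finset.mem_erase.mpr ⟨hj, Finset.mem_univ j⟩), add_assoc]
  have hnone := hx none
  have hsj := hx (some j)
  simp only [Option.elim, coordPoint, reduceCtorEq, if_false, if_neg hj] at hnone hsj
  rw [← Finset.add_sum_erase _ _ (Finset.mem_erase.mpr ⟨hj, Finset.mem_univ j⟩)] at hnone
  have hji : ¬ (some j = some i) := fun h => hj (Option.some_injective _ h)
  rw [if_neg hji] at hsj
  simp only [if_true] at hsj
  have hrest : (∑ e ∈ (Finset.univ.erase i).erase j, x (some e))
      * (((i : ℕ) - (j : ℕ) : ℤ) : ZMod N) = ∑ e ∈ (Finset.univ.erase i).erase j, w e := by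
    rw [Finset.sum_mul]
    refine Finset.sum_congr rfl fun e he => ?_
    have hej : e ≠ j := Finset.ne_of_mem_erase he
    have hei : e ≠ i := Finset.ne_of_mem_erase (Finset.mem_of_mem_erase he)
    have h1 := hx (some e)
    have h2 : ¬ (some e = some i) := fun h => hei (Option.some_injective _ h)
    have h3 : ¬ (some e = some j) := fun h => hej (Option.some_injective _ h)
    simpa only [Option.elim, coordPoint, if_neg h2, if_neg h3, if_neg hei] using h1
  rw [hsum]
  refine (hU.mul hV).mul_right_cancel ?_
  have hwj := hw j
  push_cast at *
  linear_combination ((i : ℕ) + 1 : ZMod N) * hnone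
    + (((i : ℕ) : ZMod N) - ((j : ℕ) : ZMod N)) * hsj + ((i : ℕ) + 1 : ZMod N) * hrest + hwj

/-- The bound for the ring `(ℤ/N)^(r+1) × ℤ/y` with `N` and `y` congruent to `1` modulo
`(r + 2)!`. -/
lemma gamma_mul_le_of_moduli {r h l n N y : ℕ} (hr : 2 ≤ r) (hN : N = (r + 2).factorial * h + 1)
    (hy : y = (r + 2).factorial * l + 1) (hn : r + 1 ≤ n) (hcard : n ≤ r * (N ^ (r + 1) * y)) :
    gamma n (r + 1) 2 * N ≤ r * (N ^ (r + 1) * y).choose 2 * N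
      + r * ((r + 1).factorial * h + 1) * (N ^ (r + 1) * y) ^ 2 := by
  have : NeZero N := ⟨by omega⟩
  have : NeZero y := ⟨by omega⟩
  have hRc : Fintype.card ((Option (Fin r) → ZMod N) × ZMod y) = N ^ (r + 1) * y := by
    simp [ZMod.card]
  let φ : ((Option (Fin r) → ZMod N) × ZMod y) →+ ZMod N :=
    { toFun := fun x => ∑ e, x.1 e
      map_zero' := by simp
      map_add' := by simp [Finset.sum_add_distrib] }
  have hφ : Function.Surjective φ := fun v =>
    ⟨(Pi.single none v, 0), by simp [φ]⟩
  let β : Fin r → ((Option (Fin r) → ZMod N) × ZMod y) := fun i =>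
    (fun e => (coordPoint e i : ZMod N), (coordPoint none i : ZMod y))
  have key := gamma_mul_le_of_ring (R := (Option (Fin r) → ZMod N) × ZMod y) (r := r)
    (g := (r + 1).factorial * h) (N := N) (n := n) (by omega) hn (by rw [hRc]; exact hcard)
    (by rw [hN, Nat.factorial_succ (r + 1)]; ring) φ hφ β ?_ ?_
  · rwa [hRc] at key
  · intro i j hij
    rw [Prod.isUnit_iff, Pi.isUnit_iff]
    refine ⟨fun e => ?_, ?_⟩
    · obtain ⟨h1, h2⟩ := coordPoint_sub_ne_zero e hij
      simpa [β] using isUnit_intCast_zmod hN h1 h2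
    · obtain ⟨h1, h2⟩ := coordPoint_sub_ne_zero none hij
      simpa [β] using isUnit_intCast_zmod hy h1 h2
  · intro i t
    obtain ⟨δ, hδ⟩ := exists_coord_sum_eq hN i t
    refine ⟨(δ, 0), fun j hj x hx => hδ j hj x.1 fun e => ?_⟩
    have := congrFun (congrArg Prod.fst hx) e
    simpa [β] using this

/-- For every fixed `k ≥ 3` and every `ε > 0`, there is an `N` such that for
all `n ≥ N`, `γ(G_{k,2}) ≤ ((k+3)/(2(k-1)(k+1)) + ε) · n²`. -/
theorem domination_number_Gk2_upper (k : ℕ) (hk : 3 ≤ k) (ε : ℝ) (hε : 0 < ε) :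
    ∃ N : ℕ, ∀ n : ℕ, N ≤ n →
      (gamma n k 2 : ℝ) ≤ (((k : ℝ) + 3) / (2 * ((k : ℝ) - 1) * ((k : ℝ) + 1)) + ε) * (n : ℝ) ^ 2 := by
  obtain ⟨r, rfl⟩ : ∃ r, k = r + 1 := ⟨k - 1, by omega⟩
  have hr : 2 ≤ r := by omega
  have hrR : (2 : ℝ) ≤ r := by exact_mod_cast hr
  set F := (r + 1).factorial with hF
  have hF1 : 1 ≤ F := Nat.factorial_pos _
  have hfac : (r + 2).factorial = (r + 2) * F := Nat.factorial_succ (r + 1)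
  obtain ⟨h, hh⟩ := exists_nat_gt (2 / ε)
  have hh0 : (0 : ℝ) < h := lt_trans (by positivity) hh
  set N := (r + 2).factorial * h + 1 with hN
  set C := r * N ^ (r + 1) * (r + 2).factorial with hC
  have hCpos : 0 < C := by
    have := Nat.factorial_pos (r + 2)
    have : 0 < N := by omega
    positivity
  set c : ℝ := (((r + 1 : ℕ) : ℝ) + 3) / (2 * (((r + 1 : ℕ) : ℝ) - 1) * (((r + 1 : ℕ) : ℝ) + 1))
    with hc
  have hc' : c = 1 / (2 * r) + 1 / (r * (r + 2)) := by
    rw [hc]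
    push_cast
    have : (r : ℝ) ≠ 0 := by positivity
    have : (r : ℝ) + 2 ≠ 0 := by positivity
    rw [add_sub_cancel_right, show (r : ℝ) + 1 + 1 = r + 2 by ring]
    field_simp
    ring
  have hcpos : 0 < c := by rw [hc']; positivity
  obtain ⟨M, hM⟩ := exists_nat_gt ((c + ε / 2) * (4 * C + 4 * (C : ℝ) ^ 2) / (ε / 2))
  refine ⟨max M (r + 1), fun n hn => ?_⟩
  have hnM : (M : ℝ) ≤ n := by exact_mod_cast (le_max_left _ _).trans hn
  have hnr : r + 1 ≤ n := (le_max_right _ _).trans hn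
  have hn1 : (1 : ℝ) ≤ n := by exact_mod_cast (by omega : 1 ≤ n)
  set y := (r + 2).factorial * (n / C + 1) + 1 with hy
  set ρ := N ^ (r + 1) * y with hρ
  have hrρ : r * ρ = C * (n / C + 1) + r * N ^ (r + 1) := by
    rw [hρ, hy, hC]
    ring
  have hlow : n ≤ r * ρ := by
    have := Nat.lt_mul_div_succ n hCpos
    omega
  have hupp : r * ρ ≤ n + 2 * C := by
    have h1 := Nat.mul_div_le n C
    have h2 : r * N ^ (r + 1) ≤ C := Nat.le_mul_of_pos_right _ (Nat.factorial_pos _)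
    rw [hrρ, Nat.mul_succ]
    omega
  have key := gamma_mul_le_of_moduli hr hN hy hnr hlow
  have hNR : (N : ℝ) = (r + 2) * (F * h) + 1 := by
    rw [hN, hfac]
    push_cast
    ring
  have hFR : (1 : ℝ) ≤ F := by exact_mod_cast hF1
  have hNpos : (0 : ℝ) < N := by rw [hNR]; positivity
  have hg : ((F * h + 1 : ℕ) : ℝ) ≤ N * (1 / (r + 2) + r * (ε / 2)) := by
    have h1 : (1 : ℝ) ≤ ε / 2 * h := by
      rw [div_lt_iff₀ hε] at hh
      linarith
    have h2 : (h : ℝ) ≤ r * N := by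
      have : (h : ℝ) ≤ F * h := le_mul_of_one_le_left hh0.le hFR
      have : (F * h : ℝ) ≤ (r + 2) * (F * h) := le_mul_of_one_le_left (by positivity) (by linarith)
      have : (N : ℝ) ≤ r * N := le_mul_of_one_le_left hNpos.le (by linarith)
      linarith
    have h3 : (F * h : ℝ) ≤ N * (1 / (r + 2)) := by
      rw [mul_one_div, le_div_iff₀ (by positivity), hNR]
      linarith
    have h4 : ε / 2 * h ≤ ε / 2 * (r * N) := by gcongr
    push_cast
    linarith
  have hch : ((ρ.choose 2 : ℕ) : ℝ) ≤ (ρ : ℝ) ^ 2 / 2 := by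
    have := Nat.choose_le_pow_div (α := ℝ) 2 ρ
    simpa using this
  have hgam : (gamma n (r + 1) 2 : ℝ) ≤ (c + ε / 2) * ((r : ℝ) * ρ) ^ 2 := by
    have h1 : (gamma n (r + 1) 2 : ℝ) * N ≤ r * ((ρ.choose 2 : ℕ) : ℝ) * N
        + r * ((F * h + 1 : ℕ) : ℝ) * (ρ : ℝ) ^ 2 := by exact_mod_cast key
    have h2 : (gamma n (r + 1) 2 : ℝ) * N ≤ (c + ε / 2) * ((r : ℝ) * ρ) ^ 2 * N := by
      calc _ ≤ _ := h1
        _ ≤ r * ((ρ : ℝ) ^ 2 / 2) * N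
            + r * (N * (1 / (r + 2) + r * (ε / 2))) * (ρ : ℝ) ^ 2 := by gcongr
        _ = _ := by
          rw [hc']
          have : (r : ℝ) ≠ 0 := by positivity
          have : (r : ℝ) + 2 ≠ 0 := by positivity
          field_simp
          ring
    exact le_of_mul_le_mul_right h2 hNpos
  have huppR : (r : ℝ) * ρ ≤ n + 2 * C := by exact_mod_cast hupp
  have hbig : (c + ε / 2) * (4 * C + 4 * (C : ℝ) ^ 2) ≤ ε / 2 * n := by
    rw [div_lt_iff₀ (by positivity)] at hM
    nlinarith
  calc (gamma n (r + 1) 2 : ℝ) ≤ (c + ε / 2) * ((r : ℝ) * ρ) ^ 2 := hgam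
    _ ≤ (c + ε / 2) * ((n : ℝ) + 2 * C) ^ 2 := by gcongr
    _ = (c + ε / 2) * (n : ℝ) ^ 2 + (c + ε / 2) * (4 * C * n + 4 * (C : ℝ) ^ 2 * 1) := by ring
    _ ≤ (c + ε / 2) * (n : ℝ) ^ 2 + (c + ε / 2) * (4 * C * n + 4 * (C : ℝ) ^ 2 * n) := by gcongr
    _ = (c + ε / 2) * (n : ℝ) ^ 2 + ((c + ε / 2) * (4 * C + 4 * (C : ℝ) ^ 2)) * n := by ring
    _ ≤ (c + ε / 2) * (n : ℝ) ^ 2 + (ε / 2 * n) * n := by gcongr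
    _ = (c + ε) * (n : ℝ) ^ 2 := by ring
end

section
/- Let k ≥ 3 be a fixed integer. For every ε > 0 there exists N such that for all n ≥ N: if (E,K) is a dominating set of G_{k,2} with |E| + |K| = γ(G_{k,2}) (i.e., minimizing |E|+|K|), then |E| ≥ (1/(k(k−1)) − ε) · n². -/
/-- If every `k`-subset of `s` is in `K` or contains one of the `l`-sets in `E`, then the number of
`k`-subsets of `s` is at most `|K| + |E| * (|s| - l).choose (k - l)`. -/
theorem choose_le_card_add_card_mul_choose {α : Type*} [DecidableEq α] {s : Finset α} {k l : ℕ}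
    {E K : Finset (Finset α)} (hE : ∀ e ∈ E, e ⊆ s ∧ e.card = l)
    (hK : ∀ A, A ⊆ s → A.card = k → A ∉ K → ∃ e ∈ E, e ⊆ A) :
    s.card.choose k ≤ K.card + E.card * (s.card - l).choose (k - l) := by
  have hsub : s.powersetCard k ⊆
      K ∪ E.biUnion fun e => ((s \ e).powersetCard (k - l)).image (· ∪ e) := by
    intro A hA
    obtain ⟨hAs, hAk⟩ := Finset.mem_powersetCard.mp hA
    by_cases hAK : A ∈ K
    · exact Finset.mem_union_left _ hAK
    · obtain ⟨e, he, heA⟩ := hK A hAs hAk hAK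
      refine Finset.mem_union_right _ (Finset.mem_biUnion.mpr ⟨e, he, ?_⟩)
      refine Finset.mem_image.mpr ⟨A \ e, Finset.mem_powersetCard.mpr ⟨?_, ?_⟩, ?_⟩
      · exact Finset.sdiff_subset_sdiff hAs le_rfl
      · rw [Finset.card_sdiff_of_subset heA, hAk, (hE e he).2]
      · exact Finset.sdiff_union_of_subset heA
  calc s.card.choose k = (s.powersetCard k).card := (Finset.card_powersetCard k s).symm
    _ ≤ _ := Finset.card_le_card hsub
    _ ≤ _ := Finset.card_union_le _ _
    _ ≤ K.card + E.card * (s.card - l).choose (k - l) := by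
      refine Nat.add_le_add_left (Finset.card_biUnion_le_card_mul _ _ _ fun e he => ?_) _
      refine Finset.card_image_le.trans ?_
      rw [Finset.card_powersetCard, Finset.card_sdiff_of_subset (hE e he).1, (hE e he).2]

/-- All `l`-subsets of `[n]` together form a dominating set of `G_{k,l}`. -/
theorem gamma_le_choose {n k l : ℕ} (hlk : l ≤ k) : gamma n k l ≤ n.choose l := by
  refine Nat.sInf_le ⟨(Finset.range n).powersetCard l, ∅, ⟨?_, ?_, ?_, ?_⟩, by simp⟩
  · exact fun e he => Finset.mem_powersetCard.mp he
  · simp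
  · intro A hA hAk _
    obtain ⟨e, heA, he⟩ := Finset.exists_subset_card_eq (hAk ▸ hlk : l ≤ A.card)
    exact ⟨e, Finset.mem_powersetCard.mpr ⟨heA.trans hA, he⟩, heA⟩
  · exact fun e he hl h => absurd (Finset.mem_powersetCard.mpr ⟨he, hl⟩) h

theorem le_choose_of_pos_of_lt {m j : ℕ} (hj : 0 < j) (hjm : j < m) : m ≤ m.choose j := by
  induction m generalizing j with
  | zero => omega
  | succ m ih =>
    obtain ⟨j, rfl⟩ := Nat.exists_eq_succ_of_ne_zero hj.ne'
    rw [Nat.succ_eq_add_one, Nat.choose_succ_succ]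
    rcases Nat.lt_or_ge (j + 1) m with h | h
    · have h₁ := ih hj h
      have h₂ := Nat.choose_pos (show j ≤ m by omega)
      omega
    · obtain rfl : m = j + 1 := by omega
      simp

/-- If `(E, K)` is a dominating set of `G_{k,2}` minimizing `|E| + |K|`, then
`|E| ≥ n²/(k(k-1)) + o(n²)`. -/
theorem optimal_domset_E_lower_weak (k : ℕ) (hk : 3 ≤ k) (ε : ℝ) (hε : 0 < ε) :
    ∃ N : ℕ, ∀ n : ℕ, N ≤ n → ∀ E K : Finset (Finset ℕ),
      IsDomSet n k 2 E K → E.card + K.card = gamma n k 2 →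
      (1 / ((k : ℝ) * ((k : ℝ) - 1)) - ε) * (n : ℝ) ^ 2 ≤ (E.card : ℝ) := by
  obtain ⟨N, hN⟩ := exists_nat_ge (2 / ε)
  refine ⟨max N (k + 1), fun n hn E K hD hγ => ?_⟩
  obtain ⟨hE, -, hcov, -⟩ := hD
  have hnN : 2 / ε ≤ n := hN.trans (by exact_mod_cast (le_max_left _ _).trans hn)
  have hnk : k + 1 ≤ n := (le_max_right _ _).trans hn
  have hcount := choose_le_card_add_card_mul_choose hE hcov
  have hK : K.card ≤ n.choose 2 := by
    have := gamma_le_choose (n := n) (show 2 ≤ k by omega)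
    omega
  rw [Finset.card_range] at hcount
  obtain ⟨j, rfl⟩ := Nat.exists_eq_add_of_le' (show 2 ≤ k by omega)
  obtain ⟨m, rfl⟩ := Nat.exists_eq_add_of_le' (show 2 ≤ n by omega)
  simp only [Nat.add_sub_cancel] at hcount
  have hC : m ≤ m.choose j := le_choose_of_pos_of_lt (by omega) (by omega)
  have h₁ := Nat.add_one_mul_choose_eq m j
  have h₂ := Nat.add_one_mul_choose_eq (m + 1) (j + 1)
  have hK' : 2 * K.card ≤ (m + 2) * (m + 1) := by
    have h := Nat.add_one_mul_choose_eq (m + 1) 1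
    rw [Nat.choose_one_right] at h
    linarith
  have hm : (2 : ℝ) ≤ m := by exact_mod_cast (by omega : 2 ≤ m)
  have hj : (1 : ℝ) ≤ j := by exact_mod_cast (by omega : 1 ≤ j)
  rify at hcount hC h₁ h₂ hK'
  push_cast at hnN ⊢
  rw [div_le_iff₀ hε] at hnN
  set C : ℝ := (m.choose j : ℝ)
  set x : ℝ := (E.card : ℝ)
  set y : ℝ := (K.card : ℝ)
  have hCpos : 0 < C := by linarith
  have hy : y ≤ (m + 2) * C := by nlinarith
  set D : ℝ := ((j : ℝ) + 2) * ((j : ℝ) + 2 - 1) with hD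
  have hD1 : 1 ≤ D := by nlinarith
  have hchoose : ((m : ℝ) + 2) * (m + 1) * C = ((m + 2).choose (j + 2) : ℝ) * D := by
    rw [hD]
    linear_combination ((m : ℝ) + 2) * h₁ + ((j : ℝ) + 1) * h₂
  have hmain : ((m : ℝ) + 2) * (m + 1) ≤ (m + 2 + x) * D := by
    refine le_of_mul_le_mul_right ?_ hCpos
    nlinarith
  have hdiv : ((m : ℝ) + 2) * (m + 1) / D ≤ m + 2 + x := (div_le_iff₀ (by linarith)).mpr hmain
  have hlin : ((m : ℝ) + 2) / D ≤ m + 2 := div_le_self (by linarith) hD1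
  have hsplit : 1 / D * ((m : ℝ) + 2) ^ 2 =
      ((m : ℝ) + 2) * (m + 1) / D + ((m : ℝ) + 2) / D := by ring
  rw [sub_mul, hsplit]
  nlinarith
end

section
/- Let k ≥ 3 and n > k be integers, and let T be a family of k-element subsets of [n] with |T| = t. If the auxiliary graph Q(T) is connected, then |σ₂(T)| ≤ t·(C(k,2) − 1) + 1. -/
/-- The auxiliary graph `Q(T)` on vertex set `T`: distinct `A, B ∈ T` are
adjacent iff `|A ∩ B| ≥ 2`. -/
def auxQ (T : Finset (Finset ℕ)) : SimpleGraph {A // A ∈ T} :=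
  SimpleGraph.fromRel (fun A B => 2 ≤ (A.val ∩ B.val).card)

/-- The 2-shadow `σ₂(T)`: all 2-element subsets `{i, j}` contained in some
member of `T`. -/
def sigma2 (T : Finset (Finset ℕ)) : Finset (Finset ℕ) :=
  T.sup (fun A => A.powersetCard 2)

theorem card_sigma2_insert_le {S : Finset (Finset ℕ)} {A B : Finset ℕ} (hA : A ∈ S)
    (hAB : 2 ≤ (A ∩ B).card) :
    (sigma2 (insert B S)).card ≤ (sigma2 S).card + (B.card.choose 2 - 1) := by
  have hinter : 0 < (B.powersetCard 2 ∩ sigma2 S).card := by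
    obtain ⟨p, hp, hp2⟩ := Finset.exists_subset_card_eq hAB
    refine Finset.card_pos.mpr ⟨p, Finset.mem_inter.mpr ⟨?_, ?_⟩⟩
    · exact Finset.mem_powersetCard.mpr ⟨hp.trans Finset.inter_subset_right, hp2⟩
    · exact Finset.mem_sup.mpr
        ⟨A, hA, Finset.mem_powersetCard.mpr ⟨hp.trans Finset.inter_subset_left, hp2⟩⟩
  have hunion := Finset.card_union_add_card_inter (B.powersetCard 2) (sigma2 S)
  have hsup : sigma2 (insert B S) = B.powersetCard 2 ∪ sigma2 S := Finset.sup_insert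
  rw [Finset.card_powersetCard] at hunion
  rw [hsup]
  omega

theorem exists_inter_card_of_connected {S T : Finset (Finset ℕ)} (hconn : (auxQ T).Connected)
    (hST : S ⊂ T) (hS : S.Nonempty) : ∃ A ∈ S, ∃ B ∈ T, B ∉ S ∧ 2 ≤ (A ∩ B).card := by
  obtain ⟨A, hA⟩ := hS
  obtain ⟨B, hBT, hBS⟩ := Finset.exists_of_ssubset hST
  obtain ⟨w⟩ := hconn.preconnected ⟨A, hST.subset hA⟩ ⟨B, hBT⟩
  obtain ⟨d, -, hd₁, hd₂⟩ := w.exists_boundary_dart {X | X.val ∈ S} hA hBS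
  refine ⟨d.fst, hd₁, d.snd, d.snd.2, hd₂, ?_⟩
  rcases ((SimpleGraph.fromRel_adj _ _ _).mp d.adj).2 with h | h
  · exact h
  · rwa [Finset.inter_comm]

/-- If `T` is a family of `t` many `k`-element subsets of `[n]` and `Q(T)` is
connected, then `|σ₂(T)| ≤ t(C(k,2) - 1) + 1`. -/
theorem shadow_of_connected_family (k n : ℕ) (hk : 3 ≤ k) (hn : k < n)
    (T : Finset (Finset ℕ)) (hT : ∀ A ∈ T, A ⊆ Finset.range n ∧ A.card = k)
    (t : ℕ) (ht : T.card = t) (hconn : (auxQ T).Connected) :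
    (sigma2 T).card ≤ t * (k.choose 2 - 1) + 1 := by
  subst ht
  obtain ⟨A, hA⟩ := hconn.nonempty
  have hpos : 0 < k.choose 2 := Nat.choose_pos (by omega)
  have hgrow : ∀ s, 1 ≤ s → s ≤ T.card →
      ∃ S ⊆ T, S.card = s ∧ (sigma2 S).card ≤ s * (k.choose 2 - 1) + 1 := by
    intro s hs
    induction s, hs using Nat.le_induction with
    | base =>
      refine fun _ => ⟨{A}, Finset.singleton_subset_iff.mpr hA, Finset.card_singleton A, ?_⟩
      rw [sigma2, Finset.sup_singleton, Finset.card_powersetCard, (hT A hA).2]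
      omega
    | succ s hs ih =>
      intro hsT
      obtain ⟨S, hST, rfl, hcard⟩ := ih (by omega)
      obtain ⟨C, hC, B, hBT, hBS, hCB⟩ := exists_inter_card_of_connected hconn
        (hST.ssubset_of_ne (by rintro rfl; omega)) (Finset.card_pos.mp hs)
      refine ⟨insert B S, Finset.insert_subset hBT hST, Finset.card_insert_of_notMem hBS, ?_⟩
      have hinsert := card_sigma2_insert_le hC hCB
      rw [(hT B hBT).2] at hinsert
      rw [Nat.succ_mul]
      omega
  obtain ⟨S, hST, hcard, hbound⟩ := hgrow T.card (Finset.card_pos.mpr ⟨A, hA⟩) le_rfl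
  rwa [Finset.eq_of_subset_of_card_le hST hcard.ge] at hbound
end

section
/- Let k ≥ 3 and n > k be integers, let s > 1 be an integer, and let K₂ be a family of k-element subsets of [n] such that every connected component of the graph Q(K₂) has at least s vertices. Then |σ₂(K₂)| ≤ (C(k,2) − 1 + 1/s) · |K₂|. -/
/-- In a finite graph whose components all have at least `s` vertices, one root per component and
the distance to it give a height function that every non-root can lower along an edge. -/
theorem SimpleGraph.exists_roots_height {V : Type*} [Fintype V] (G : SimpleGraph V) (s : ℕ)
    (hcomp : ∀ v, s ≤ (G.connectedComponentMk v).supp.ncard) :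
    ∃ (R : Finset V) (d : V → ℕ), s * R.card ≤ Fintype.card V ∧
      ∀ v ∉ R, ∃ w, G.Adj v w ∧ d w < d v := by
  classical
  let r : V → V := fun v => (G.connectedComponentMk v).out
  have hr (v : V) : G.connectedComponentMk (r v) = G.connectedComponentMk v := Quot.out_eq _
  refine ⟨Finset.univ.filter fun v => r v = v, fun v => G.dist v (r v), ?_, fun v hv => ?_⟩
  · have hinj : Set.InjOn G.connectedComponentMk
        ((Finset.univ.filter fun v => r v = v : Finset V) : Set V) := by
      intro v hv w hw h
      simp only [Finset.coe_filter, Finset.mem_univ, true_and, Set.mem_ofPred_eq] at hv hw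
      rw [← hv, ← hw]
      exact congrArg Quot.out h
    rw [← Finset.card_image_of_injOn hinj, mul_comm]
    rw [← Finset.card_univ,
      Finset.card_eq_sum_card_image G.connectedComponentMk (Finset.univ : Finset V)]
    refine (Nat.mul_le_mul_right s
      (Finset.card_le_card (Finset.image_subset_image (Finset.filter_subset _ _)))).trans ?_
    rw [← smul_eq_mul]
    refine Finset.card_nsmul_le_sum _ _ _ fun c hc => ?_
    obtain ⟨v, -, rfl⟩ := Finset.mem_image.mp hc
    refine (hcomp v).trans_eq ?_
    rw [← Set.ncard_coe_finset]
    congr 1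
    ext w
    simp
  · have hne : r v ≠ v := by simpa using hv
    have hreach : G.Reachable v (r v) := SimpleGraph.ConnectedComponent.exact (hr v).symm
    obtain ⟨p, hp⟩ := hreach.exists_walk_length_eq_dist
    generalize hx : r v = x at p hp hne
    cases p with
    | nil => exact absurd rfl hne
    | @cons _ w _ h q =>
      have hw : r w = x := by
        rw [← hx]
        exact congrArg Quot.out (SimpleGraph.ConnectedComponent.sound h.symm.reachable)
      refine ⟨w, h, ?_⟩
      have hq := SimpleGraph.dist_le q
      simp only [SimpleGraph.Walk.length_cons] at hp
      change G.dist w (r w) < G.dist v (r v)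
      rw [hw, hx]
      omega

theorem mem_sigma2 {T : Finset (Finset ℕ)} {e : Finset ℕ} :
    e ∈ sigma2 T ↔ ∃ A ∈ T, e ⊆ A ∧ e.card = 2 := by
  simp [sigma2, Finset.mem_sup, Finset.mem_powersetCard]

/-- A set outside `R` shares a pair with a lower set, so it contributes at most
`k.choose 2 - 1` pairs whose first occurrence is in it. -/
theorem card_sigma2_add_card_le {k : ℕ} {T : Finset (Finset ℕ)} (hT : ∀ A ∈ T, A.card = k)
    (R : Finset {A // A ∈ T}) (d : {A // A ∈ T} → ℕ)
    (hd : ∀ A ∉ R, ∃ B, (auxQ T).Adj A B ∧ d B < d A) :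
    (sigma2 T).card + T.card ≤ k.choose 2 * T.card + R.card := by
  classical
  have hpair (A : {A // A ∈ T}) (hA : A ∉ R) :
      ∃ e ⊆ A.val, e.card = 2 ∧ ∃ B : {A // A ∈ T}, e ⊆ B.val ∧ d B < d A := by
    obtain ⟨B, hAB, hlt⟩ := hd A hA
    have hcard : 2 ≤ (A.val ∩ B.val).card := by
      rw [auxQ, SimpleGraph.fromRel_adj, Finset.inter_comm B.val, or_self] at hAB
      exact hAB.2
    obtain ⟨e, he, he2⟩ := Finset.exists_subset_card_eq hcard
    exact ⟨e, he.trans Finset.inter_subset_left, he2, B, he.trans Finset.inter_subset_right, hlt⟩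
  choose! f hfA hf2 hfB using hpair
  let P : {A // A ∈ T} → Finset (Finset ℕ) := fun A =>
    if A ∈ R then A.val.powersetCard 2 else (A.val.powersetCard 2).erase (f A)
  have hP (A : {A // A ∈ T}) : (P A).card + 1 = k.choose 2 + if A ∈ R then 1 else 0 := by
    by_cases hA : A ∈ R
    · simp [P, hA, Finset.card_powersetCard, hT A A.2]
    · have hmem : f A ∈ A.val.powersetCard 2 := Finset.mem_powersetCard.mpr ⟨hfA A hA, hf2 A hA⟩
      simp only [P, hA, if_false, Finset.card_erase_add_one hmem, Finset.card_powersetCard,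
        hT A A.2, add_zero]
  have hsub : sigma2 T ⊆ Finset.univ.biUnion P := by
    intro e he
    obtain ⟨A₀, hA₀, heA₀, he2⟩ := mem_sigma2.mp he
    obtain ⟨A, hA, hmin⟩ := Finset.exists_min_image
      (Finset.univ.filter fun A : {A // A ∈ T} => e ⊆ A.val) d ⟨⟨A₀, hA₀⟩, by simpa using heA₀⟩
    have heA : e ⊆ A.val := by simpa using hA
    have hmem : e ∈ A.val.powersetCard 2 := Finset.mem_powersetCard.mpr ⟨heA, he2⟩
    refine Finset.mem_biUnion.mpr ⟨A, Finset.mem_univ A, ?_⟩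
    by_cases hR : A ∈ R
    · simpa only [P, hR, if_true] using hmem
    · simp only [P, hR, if_false]
      refine Finset.mem_erase.mpr ⟨fun hef => ?_, hmem⟩
      obtain ⟨B, hB, hlt⟩ := hfB A hR
      have := hmin B (by simpa [hef] using hB)
      omega
  have hsum : ∑ A, ((P A).card + 1) = k.choose 2 * T.card + R.card := by
    rw [Finset.sum_congr rfl fun A _ => hP A]
    simp [-Finset.univ_eq_attach, Finset.sum_add_distrib, mul_comm]
  have hle := (Finset.card_le_card hsub).trans Finset.card_biUnion_le
  simp only [Finset.sum_add_distrib, Finset.sum_const, Finset.card_univ, Fintype.card_coe,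
    smul_eq_mul, mul_one] at hsum
  omega

/-- If every connected component of `Q(K₂)` has at least `s` vertices, then
`|σ₂(K₂)| ≤ (C(k,2) - 1 + 1/s) |K₂|`. -/
theorem shadow_of_big_components (k n s : ℕ) (hk : 3 ≤ k) (hn : k < n) (hs : 1 < s)
    (K₂ : Finset (Finset ℕ)) (hK₂ : ∀ A ∈ K₂, A ⊆ Finset.range n ∧ A.card = k)
    (hcomp : ∀ v : {A // A ∈ K₂}, s ≤ ((auxQ K₂).connectedComponentMk v).supp.ncard) :
    ((sigma2 K₂).card : ℝ) ≤ ((k.choose 2 : ℝ) - 1 + 1 / (s : ℝ)) * (K₂.card : ℝ) := by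
  obtain ⟨R, d, hR, hd⟩ := (auxQ K₂).exists_roots_height s hcomp
  have h := card_sigma2_add_card_le (fun A hA => (hK₂ A hA).2) R d hd
  rw [Fintype.card_coe] at hR
  have hs0 : (0 : ℝ) < s := by exact_mod_cast (by omega : 0 < s)
  have hR' : (R.card : ℝ) ≤ 1 / (s : ℝ) * K₂.card := by
    rw [one_div_mul_eq_div, le_div_iff₀ hs0, mul_comm]
    exact_mod_cast hR
  have h' : ((sigma2 K₂).card : ℝ) + K₂.card ≤ k.choose 2 * K₂.card + R.card := by
    exact_mod_cast h
  linarith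
end

section
/- Let n > k ≥ 3 and s > 1 be integers, and let (E,K) be a dominating set of G_{k,2}. Let K₀ be the family of those members of K containing some member of E as a subset; let K₂ be the family of those members of K − K₀ lying in connected components of Q(K − K₀) of size at least s; and let K₁ = K − K₀ − K₂. Then |E| + (C(k,2) − 1)·|K₀| + |σ₂(K₁)| + |σ₂(K₂)| ≥ C(n,2). -/
/-- The members of `T` lying in a connected component of `Q(T)` with at least
`s` vertices. -/
noncomputable def bigComponentMembers (s : ℕ) (T : Finset (Finset ℕ)) : Finset (Finset ℕ) :=
  (T.attach.filter (fun A => s ≤ ((auxQ T).connectedComponentMk A).supp.ncard)).image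
    Subtype.val

/-- A `k`-set containing a member of a family `E` of pairs contains at most `C(k, 2) - 1` pairs
outside `E`. -/
theorem card_powersetCard_two_sdiff_le {E : Finset (Finset ℕ)} {A e : Finset ℕ}
    (he : e ∈ E) (hcard : e.card = 2) (heA : e ⊆ A) :
    (A.powersetCard 2 \ E).card ≤ A.card.choose 2 - 1 := by
  have hmem : e ∈ A.powersetCard 2 := Finset.mem_powersetCard.2 ⟨heA, hcard⟩
  rw [← Finset.card_powersetCard, ← Finset.card_erase_of_mem hmem]
  refine Finset.card_le_card fun f hf => ?_
  rw [Finset.mem_sdiff] at hf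
  exact Finset.mem_erase.2 ⟨fun hfe => hf.2 (hfe ▸ he), hf.1⟩

/-- If `(E, K)` is a dominating set of `G_{k,2}`, `K₀` consists of the members
of `K` containing a member of `E`, `K₂` consists of the members of `K - K₀`
lying in components of `Q(K - K₀)` of size at least `s`, and `K₁ = K - K₀ - K₂`,
then `|E| + (C(k,2) - 1)·|K₀| + |σ₂(K₁)| + |σ₂(K₂)| ≥ C(n, 2)`. -/
theorem domset_counting_pairs_refined (n k s : ℕ) (hk : 3 ≤ k) (hn : k < n) (hs : 1 < s)
    (E K K₀ K₁ K₂ : Finset (Finset ℕ)) (h : IsDomSet n k 2 E K)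
    (hK₀ : K₀ = K.filter (fun A => ∃ e ∈ E, e ⊆ A))
    (hK₂ : K₂ = bigComponentMembers s (K \ K₀))
    (hK₁ : K₁ = (K \ K₀) \ K₂) :
    n.choose 2 ≤ E.card + (k.choose 2 - 1) * K₀.card + (sigma2 K₁).card + (sigma2 K₂).card := by
  obtain ⟨hE, hK, -, hcover⟩ := h
  have hsub : (Finset.range n).powersetCard 2 ⊆
      E ∪ K₀.biUnion (fun A => A.powersetCard 2 \ E) ∪ sigma2 K₁ ∪ sigma2 K₂ := by
    intro e he
    obtain ⟨hen, hcard⟩ := Finset.mem_powersetCard.1 he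
    simp only [Finset.mem_union, Finset.mem_biUnion, Finset.mem_sdiff, mem_sigma2,
      Finset.mem_powersetCard]
    by_cases heE : e ∈ E
    · exact Or.inl (Or.inl (Or.inl heE))
    obtain ⟨A, hA, heA⟩ := hcover e hen hcard heE
    by_cases h0 : A ∈ K₀
    · exact Or.inl (Or.inl (Or.inr ⟨A, h0, ⟨heA, hcard⟩, heE⟩))
    by_cases h2 : A ∈ K₂
    · exact Or.inr ⟨A, h2, heA, hcard⟩
    · refine Or.inl (Or.inr ⟨A, ?_, heA, hcard⟩)
      rw [hK₁]
      exact Finset.mem_sdiff.2 ⟨Finset.mem_sdiff.2 ⟨hA, h0⟩, h2⟩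
  have hbound : (K₀.biUnion (fun A => A.powersetCard 2 \ E)).card ≤
      (k.choose 2 - 1) * K₀.card := by
    rw [mul_comm]
    refine Finset.card_biUnion_le_card_mul _ _ _ fun A hA => ?_
    rw [hK₀, Finset.mem_filter] at hA
    obtain ⟨hAK, e, he, heA⟩ := hA
    exact (hK A hAK).2 ▸ card_powersetCard_two_sdiff_le he (hE e he).2 heA
  calc n.choose 2 = ((Finset.range n).powersetCard 2).card := by simp
    _ ≤ (E ∪ K₀.biUnion (fun A => A.powersetCard 2 \ E) ∪ sigma2 K₁ ∪ sigma2 K₂).card :=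
      Finset.card_le_card hsub
    _ ≤ E.card + (K₀.biUnion (fun A => A.powersetCard 2 \ E)).card + (sigma2 K₁).card +
        (sigma2 K₂).card := by
      refine (Finset.card_union_le _ _).trans ?_
      gcongr
      refine (Finset.card_union_le _ _).trans ?_
      gcongr
      exact Finset.card_union_le _ _
    _ ≤ _ := by gcongr
end
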